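/- Let T be a shifted tableau. If unprime(T) is increasing then row(T) ~ᴷ col(T). Consequently, if T is increasing and z ∈ I_ℤ, then row(T) ∈ R_inv^+(z) if and only if col(T) ∈ R_inv^+(z), and in this case row(T) ~ᴷ col(T). -/

import Mathlib

/-! ## Primed letters: the alphabet `ℤ ⊔ ℤ'`, with `i' = i - 1/2`.
A letter is encoded by its "ceiling" together with a flag recording whether it is primed. -/

structure Letter where
  ceil : ℤ
  primed : Bool
deriving DecidableEq, Repr

instance : Inhabited Letter := ⟨⟨0, false⟩⟩

/-- The order `⋯ < 1' < 1 < 2' < 2 < ⋯`. -/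
instance : LinearOrder Letter :=
  LinearOrder.lift' (fun x : Letter => toLex (x.ceil, !x.primed))
    (fun a b h => by
      have h' : (a.ceil, !a.primed) = (b.ceil, !b.primed) := toLex.injective h
      obtain ⟨ac, ap⟩ := a
      obtain ⟨bc, bp⟩ := b
      simp only [Prod.mk.injEq] at h'
      obtain ⟨h1, h2⟩ := h'
      cases ap <;> cases bp <;> simp_all)

/-- A primed word. -/
abbrev PWord := List Letter

def Letter.unprime (x : Letter) : Letter := ⟨x.ceil, false⟩

def Letter.succL (x : Letter) : Letter := ⟨x.ceil + 1, x.primed⟩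

/-- `unprime` of a primed word: replace each letter `x` by `⌈x⌉`. -/
def unprimeWord (a : PWord) : List ℤ := a.map Letter.ceil

/-- `unprime` of a primed word, as a primed word with no primes. -/
def unprimeP (a : PWord) : PWord := a.map Letter.unprime

/-! ## Involution words -/

/-- The simple transposition `s_i = (i, i+1)` of `ℤ`. -/
def sPerm (i : ℤ) : Equiv.Perm ℤ := Equiv.swap i (i + 1)

/-- The Demazure product `s_{w_1} ∘ s_{w_2} ∘ ⋯ ∘ s_{w_k}` of a word, computed by the
defining recursion `σ ∘ s_i = σ·s_i` if `σ(i) < σ(i+1)` and `σ ∘ s_i = σ` otherwise. -/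
def heckeProd (w : List ℤ) : Equiv.Perm ℤ :=
  w.foldl (fun σ i => if σ i < σ (i + 1) then σ * sPerm i else σ) 1

/-- `s_{a_n} ∘ ⋯ ∘ s_{a_2} ∘ s_{a_1} ∘ s_{a_2} ∘ ⋯ ∘ s_{a_n}` for `a = a_1 a_2 ⋯ a_n`. -/
def invHecke (a : List ℤ) : Equiv.Perm ℤ := heckeProd (a.reverse ++ a.tail)

/-- Membership in `I_ℤ`: a finitely supported involution of `ℤ`. -/
def IZ (z : Equiv.Perm ℤ) : Prop := {x : ℤ | z x ≠ x}.Finite ∧ z * z = 1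

/-- The set of involution words of `z`. -/
def Rinv (z : Equiv.Perm ℤ) : Set (List ℤ) :=
  {a | invHecke a = z ∧ ∀ b : List ℤ, invHecke b = z → a.length ≤ b.length}

/-- 0-based index `k` is a commutation in the word `a` (this corresponds to the 1-based
index `k+1`): `a_{k+1}` and `a_{k+1} + 1` are both fixed points of
`s_{a_k} ∘ ⋯ ∘ s_{a_1} ∘ ⋯ ∘ s_{a_k}`. -/
def IsCommutation (a : List ℤ) (k : ℕ) : Prop :=
  ∃ x, a[k]? = some x ∧ invHecke (a.take k) x = x ∧ invHecke (a.take k) (x + 1) = x + 1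

/-- The set of primed involution words of `z`. -/
def RinvPlus (z : Equiv.Perm ℤ) : Set PWord :=
  {a | unprimeWord a ∈ Rinv z ∧
     ∀ (k : ℕ) (x : Letter), a[k]? = some x → x.primed = true →
       IsCommutation (unprimeWord a) k}

/-! ## Shifted tableaux.
A shifted tableau is recorded as its list of rows, from the first (bottom) row upward;
the entry at 0-based index `k` of 0-based row `r` occupies the box in row `r+1` and
column `r+1+k` of the shifted diagram. -/

abbrev STab := List (List Letter)

/-- A strict partition, recorded as its (strictly decreasing) list of positive parts. -/
def IsStrictPartition (sh : List ℕ) : Prop :=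
  List.Chain' (fun a b => b < a) sh ∧ ∀ m ∈ sh, 0 < m

def shapeOf {α : Type*} (T : List (List α)) : List ℕ := T.map List.length

/-- The rows form the shifted diagram of a strict partition. -/
def IsShifted {α : Type*} (T : List (List α)) : Prop := IsStrictPartition (shapeOf T)

/-- The entry of `T` in (0-based) row `r` and column `c` of the shifted diagram. -/
def entryG? {α : Type*} (T : List (List α)) (r c : ℕ) : Option α :=
  if r ≤ c then (T[r]?).bind (fun row => row[c - r]?) else none

def entry? (T : STab) (r c : ℕ) : Option Letter := entryG? T r c

def setRowG {α : Type*} (T : List (List α)) (r : ℕ) (row : List α) : List (List α) :=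
  if r < T.length then T.set r row else T ++ [row]

def setEntryG {α : Type*} (T : List (List α)) (r c : ℕ) (x : α) : List (List α) :=
  T.set r ((T.getD r []).set (c - r) x)

def numCols {α : Type*} (T : List (List α)) : ℕ := (T.getD 0 []).length

/-- Row reading word: rows left to right, starting with the last (top) row. -/
def rowWord (T : STab) : PWord := T.reverse.flatten

/-- Column reading word: columns top to bottom, starting with the first column. -/
def colWord (T : STab) : PWord :=
  (List.range (numCols T)).flatMap (fun c =>
    ((List.range (c + 1)).reverse).filterMap (fun r => entry? T r c))

def unprimeT (T : STab) : STab := T.map (List.map Letter.unprime)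

/-- Remove the primes from all main-diagonal entries. -/
def unprimeDiagT (T : STab) : STab :=
  T.map (fun row =>
    match row with
    | [] => []
    | x :: rest => Letter.unprime x :: rest)

/-- Rows and columns are strictly increasing. -/
def IsIncreasing (T : STab) : Prop :=
  (∀ r c x y, entry? T r c = some x → entry? T r (c + 1) = some y → x < y) ∧
  (∀ r c x y, entry? T r c = some x → entry? T (r + 1) c = some y → x < y)

/-- No primed entries on the main diagonal. -/
def NoDiagPrimes (T : STab) : Prop :=
  ∀ r x, entry? T r r = some x → x.primed = false

/-- Entries positive, rows and columns weakly increasing, no primed entry repeated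
in a row and no unprimed entry repeated in a column. -/
def IsSemistandard (T : STab) : Prop :=
  (∀ x ∈ T.flatten, 0 < x.ceil) ∧
  (∀ r c x y, entry? T r c = some x → entry? T r (c + 1) = some y → x ≤ y) ∧
  (∀ r c x y, entry? T r c = some x → entry? T (r + 1) c = some y → x ≤ y) ∧
  (∀ r c c' x, c < c' → entry? T r c = some x → entry? T r c' = some x →
    x.primed = false) ∧
  (∀ r r' c x, r < r' → entry? T r c = some x → entry? T r' c = some x →
    x.primed = true)

/-- Increasing, with exactly one of `i` or `i'` as an entry for each `i = 1, …, n`,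
where `n` is the number of boxes. -/
def IsStandard (T : STab) : Prop :=
  IsIncreasing T ∧
  ∀ i : ℤ, 1 ≤ i → i ≤ (T.flatten.length : ℤ) →
    T.flatten.countP (fun x => decide (x.ceil = i)) = 1
/-! ## Orthogonal Edelman–Greene insertion -/

/-- "Switching the primes" of a pair: reverse the primes on both letters if exactly one
of them is unprimed, and leave them unchanged otherwise. -/
def switchPrimes (x y : Letter) : Letter × Letter :=
  if x.primed = y.primed then (x, y)
  else (⟨x.ceil, !x.primed⟩, ⟨y.ceil, !y.primed⟩)

/-- Column-insertion stage of orthogonal Edelman–Greene insertion: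
insert letter `w` into column `c` of `T` (then continue into later columns). -/
def egCol : ℕ → STab → ℕ → Letter → STab × Bool
  | 0, T, _, _ => (T, true)
  | fuel + 1, T, c, w =>
    let occ := (List.range (c + 1)).filterMap (fun r => (entry? T r c).map (fun x => (r, x)))
    match occ.findIdx? (fun p => decide (w.ceil < p.2.ceil)) with
    | none =>
        -- place `w` in the first empty box of the column
        let r := occ.length
        let w' := if r = c ∧ w.primed then Letter.unprime w else w
        (setRowG T r ((T.getD r []) ++ [w']), if r = c then w.primed else true)
    | some kM =>
        let km := (occ.findIdx? (fun p => decide (w.ceil ≤ p.2.ceil))).getD kM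
        let im := (occ.getD km (0, default)).1
        let m := (occ.getD km (0, default)).2
        if km = kM then
          if im = c then
            -- m = M on the main diagonal
            egCol fuel (setEntryG T im c (Letter.unprime w)) (c + 1) ⟨m.ceil, w.primed⟩
          else
            -- m = M off the main diagonal
            egCol fuel (setEntryG T im c w) (c + 1) m
        else
          -- m < M : switch the primes on m and M, insert w+1 into the next column
          let iM := (occ.getD kM (0, default)).1
          let M := (occ.getD kM (0, default)).2
          let p := switchPrimes m M
          egCol fuel (setEntryG (setEntryG T im c p.1) iM c p.2) (c + 1) (Letter.succL w)

/-- Row-insertion stage of orthogonal Edelman–Greene insertion: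
insert letter `w` into row `r` of `T`. -/
def egRow : ℕ → STab → ℕ → Letter → STab × Bool
  | 0, T, _, _ => (T, true)
  | fuel + 1, T, r, w =>
    let row := T.getD r []
    match row.findIdx? (fun x => decide (w.ceil < x.ceil)) with
    | none =>
        if row.isEmpty ∧ w.primed then (setRowG T r [Letter.unprime w], true)
        else (setRowG T r (row ++ [w]), false)
    | some kM =>
        let km := (row.findIdx? (fun x => decide (w.ceil ≤ x.ceil))).getD kM
        let m := row.getD km default
        if km = kM then
          if km = 0 then
            -- m = M on the main diagonal
            egCol fuel (setRowG T r (row.set 0 (Letter.unprime w))) (r + 1)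
              ⟨m.ceil, w.primed⟩
          else
            -- m = M off the main diagonal
            egRow fuel (setRowG T r (row.set km w)) (r + 1) m
        else
          -- m < M : switch primes; insert w+1 into the next column (if m is on the
          -- main diagonal) or the next row (otherwise)
          let M := row.getD kM default
          let p := switchPrimes m M
          let row' := (row.set km p.1).set kM p.2
          if km = 0 then egCol fuel (setRowG T r row') (r + 1) (Letter.succL w)
          else egRow fuel (setRowG T r row') (r + 1) (Letter.succL w)

/-- `T ←ᴼ u` together with the flag recording whether the insertion ended in
column insertion. -/
def egInsert (T : STab) (u : Letter) : STab × Bool :=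
  egRow (T.flatten.length + T.length + 2) T 0 u

/-- The orthogonal Edelman–Greene insertion tableau `P_EGᴼ(a)`. -/
def PEG (a : PWord) : STab := a.foldl (fun T u => (egInsert T u).1) []

/-- Add the recording letter `x` to `Q` in the unique box of `Pnew` not in `Pold`. -/
def addBox (Q Pold Pnew : STab) (x : Letter) : STab :=
  match (List.range Pnew.length).find?
      (fun r => decide ((Pold.getD r []).length ≠ (Pnew.getD r []).length)) with
  | some r => setRowG Q r ((Q.getD r []) ++ [x])
  | none => Q

def QEGaux : STab → STab → ℕ → PWord → STab
  | _, Q, _, [] => Q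
  | P, Q, n, u :: rest =>
      let res := egInsert P u
      QEGaux res.1 (addBox Q P res.1 ⟨(n : ℤ), res.2⟩) (n + 1) rest

/-- The orthogonal Edelman–Greene recording tableau `Q_EGᴼ(a)`. -/
def QEG (a : PWord) : STab := QEGaux [] [] 1 a

/-! ## Orthogonal Coxeter–Knuth operators -/

def ock1 (x : Letter) : Letter := ⟨x.ceil, !x.primed⟩

def ock2 (x y : Letter) : Letter × Letter := (⟨y.ceil, x.primed⟩, ⟨x.ceil, y.primed⟩)

def ock3 (x y z : Letter) : Letter × Letter × Letter :=
  if x.ceil = z.ceil ∧ (x.ceil - y.ceil = 1 ∨ y.ceil - x.ceil = 1) then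
    if x.primed = false ∧ y.primed = false ∧ z.primed = false then
      -- XYX ↔ YXY
      (⟨y.ceil, false⟩, ⟨x.ceil, false⟩, ⟨y.ceil, false⟩)
    else if x.primed = true ∧ y.primed = false ∧ z.primed = false then
      -- X'YX ↦ YXY'
      (⟨y.ceil, false⟩, ⟨x.ceil, false⟩, ⟨y.ceil, true⟩)
    else if x.primed = false ∧ y.primed = false ∧ z.primed = true then
      -- YXY' ↦ X'YX
      (⟨y.ceil, true⟩, ⟨x.ceil, false⟩, ⟨y.ceil, false⟩)
    else (x, y, z)
  else if (x.ceil < z.ceil ∧ z.ceil < y.ceil) ∨ (y.ceil < z.ceil ∧ z.ceil < x.ceil) then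
    -- ACB ↔ CAB
    (y, x, z)
  else if (y.ceil < x.ceil ∧ x.ceil < z.ceil) ∨ (z.ceil < x.ceil ∧ x.ceil < y.ceil) then
    -- BCA ↔ BAC
    (x, z, y)
  else (x, y, z)

/-- The operator `ock_i` for `i ∈ ℤ`. -/
def ockW (i : ℤ) (a : PWord) : PWord :=
  if i = -1 then
    match a with
    | [] => []
    | x :: rest => ock1 x :: rest
  else if i = 0 then
    match a with
    | x :: y :: rest => (ock2 x y).1 :: (ock2 x y).2 :: rest
    | _ => a
  else if 1 ≤ i ∧ i + 2 ≤ (a.length : ℤ) then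
    let k := (i - 1).toNat
    match a[k]?, a[k + 1]?, a[k + 2]? with
    | some x, some y, some z =>
        a.take k ++ [(ock3 x y z).1, (ock3 x y z).2.1, (ock3 x y z).2.2] ++ a.drop (k + 3)
    | _, _, _ => a
  else a

/-- Orthogonal Coxeter–Knuth equivalence: generated by `a ∼ ock_i(a)` for all `i ∈ ℤ`. -/
def OckEquiv : PWord → PWord → Prop :=
  Relation.EqvGen (fun a b => ∃ i : ℤ, b = ockW i a)
/-! ## Descents -/

/-- Descent set of a primed word (as a set of 1-based positions). -/
def DesWord (a : PWord) : Set ℤ :=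
  {i | ∃ k : ℕ, i = (k : ℤ) + 1 ∧ ∃ x y, a[k]? = some x ∧ a[k + 1]? = some y ∧ y < x}

/-- Descent set of a standard shifted tableau. -/
def DesT (T : STab) : Set ℤ :=
  {i | 0 < i ∧ (
    (∃ r c r' c', entry? T r c = some ⟨i, false⟩ ∧
        entry? T r' c' = some ⟨i + 1, false⟩ ∧ r < r') ∨
    (∃ r c r' c', entry? T r c = some ⟨i, true⟩ ∧
        entry? T r' c' = some ⟨i + 1, true⟩ ∧ c < c') ∨
    (∃ r c r' c', entry? T r c = some ⟨i, false⟩ ∧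
        entry? T r' c' = some ⟨i + 1, true⟩))}

/-! ## Dual equivalence operators on standard shifted tableaux -/

def numPrimes (T : STab) : ℕ := T.flatten.countP (fun x => x.primed)

/-- The entries of column `c`, read from bottom to top (increasing). -/
def colLetters (T : STab) (c : ℕ) : PWord :=
  (List.range (c + 1)).filterMap (fun r => entry? T r c)

/-- The shifted reading word `unprime(C_q R_q ⋯ C_1 R_1)`. -/
def shword (T : STab) : List ℤ :=
  (((List.range (numCols T)).reverse).flatMap (fun idx =>
    (colLetters T idx).filter (fun x => x.primed) ++
      ((T.getD idx []).filter (fun x => !x.primed)))).map Letter.ceil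

def idxOfZ (v : ℤ) : List ℤ → ℕ
  | [] => 0
  | x :: r => if x = v then 0 else idxOfZ v r + 1

def positionsOf (T : STab) : List (ℕ × ℕ) :=
  (List.range T.length).flatMap (fun r =>
    (List.range (T.getD r []).length).map (fun k => (r, r + k)))

/-- The box `□_v` of `T` containing `v` or `v'`. -/
def boxOf (T : STab) (v : ℤ) : Option (ℕ × ℕ) :=
  (positionsOf T).find? (fun p =>
    match entry? T p.1 p.2 with
    | some x => decide (x.ceil = v)
    | none => false)

/-- Reverse the prime of the entry in position `(r, c)`. -/
def togglePos (T : STab) (r c : ℕ) : STab :=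
  match entry? T r c with
  | some x => setEntryG T r c ⟨x.ceil, !x.primed⟩
  | none => T

/-- Switch the primes of the entries in the two given positions. -/
def switchAt (T : STab) (p q : ℕ × ℕ) : STab :=
  match entry? T p.1 p.2, entry? T q.1 q.2 with
  | some x, some y =>
      if x.primed = y.primed then T else togglePos (togglePos T p.1 p.2) q.1 q.2
  | _, _ => T

/-- The row index of `□_v` if it is a main-diagonal box. -/
def diagBox? (T : STab) (v : ℤ) : Option ℕ :=
  (boxOf T v).bind (fun p => if p.1 = p.2 then some p.1 else none)

def switchDiag (T T' : STab) (u v : ℤ) : STab :=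
  match diagBox? T u, diagBox? T v with
  | some r, some s => switchAt T' (r, r) (s, s)
  | _, _ => T'

/-- The operator `𝔰_i`. -/
def sOp (i : ℤ) (T : STab) : STab :=
  match boxOf T i, boxOf T (i + 1) with
  | some (r1, c1), some (r2, c2) =>
      if r1 ≠ r2 ∧ c1 ≠ c2 then
        -- swap i ↔ i+1 and i' ↔ (i+1)'
        setEntryG (setEntryG T r1 c1 ⟨i + 1, ((entry? T r1 c1).getD default).primed⟩)
          r2 c2 ⟨i, ((entry? T r2 c2).getD default).primed⟩
      else if r1 ≠ c1 ∧ r2 ≠ c2 then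
        -- same row or column, neither box diagonal: reverse both primes
        togglePos (togglePos T r1 c1) r2 c2
      else
        -- same row or column, one box diagonal
        let T1 := if r1 = c1 then togglePos T r2 c2 else togglePos T r1 c1
        let T2 :=
          if 1 ≤ i - 1 ∧ (diagBox? T (i - 1)).isSome ∧ (diagBox? T (i + 1)).isSome then
            switchDiag T T1 (i - 1) (i + 1)
          else T1
        if i + 2 ≤ (T.flatten.length : ℤ) ∧ (diagBox? T i).isSome ∧
            (diagBox? T (i + 2)).isSome then
          switchDiag T T2 i (i + 2)
        else T2
  | _, _ => T

def btwn (a m b : ℕ) : Prop := (a < m ∧ m < b) ∨ (b < m ∧ m < a)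

instance (a m b : ℕ) : Decidable (btwn a m b) := by unfold btwn; infer_instance

/-- The dual equivalence operator `𝔡_i` for `i ∈ ℤ`. -/
def dOp (i : ℤ) (T : STab) : STab :=
  if ¬(1 ≤ i + 2 ∧ i + 2 ≤ (T.flatten.length : ℤ)) then T
  else if i = -1 then togglePos T 0 0
  else if i = 0 then togglePos T 0 1
  else
    let w := shword T
    if btwn (idxOfZ i w) (idxOfZ (i + 2) w) (idxOfZ (i + 1) w) then sOp i T
    else if btwn (idxOfZ (i + 1) w) (idxOfZ i w) (idxOfZ (i + 2) w) then sOp (i + 1) T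
    else T

/-! ## Marked cycles -/

/-- The 2-cycles of `z`, as ordered pairs `(i, j)` with `i < j = z(i)`. -/
def cycSet (z : Equiv.Perm ℤ) : Set (ℤ × ℤ) := {p | p.1 < p.2 ∧ z p.1 = p.2}

/-- `s_{a_n} ⋯ s_{a_{k+2}} s_{a_{k+1}}` (ordinary product; 0-based index `k`). -/
def suffixPerm (a : List ℤ) (k : ℕ) : Equiv.Perm ℤ :=
  ((a.drop (k + 1)).reverse.map sPerm).prod

/-- `γ_{k+1}(a)` as an ordered pair (junk value `(0,0)` off the commutation set). -/
def gammaPair (a : List ℤ) (k : ℕ) : ℤ × ℤ :=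
  match a[k]? with
  | some x => (min (suffixPerm a k x) (suffixPerm a k (x + 1)),
               max (suffixPerm a k x) (suffixPerm a k (x + 1)))
  | none => (0, 0)
/-! ## Increasing factorization sequences and Schur Q-functions -/

/-- `Incr_∞(R_inv^+(z))`: sequences of weakly increasing primed words, all but
finitely many empty, whose concatenation is a primed involution word for `z`. -/
def IncrSeq (z : Equiv.Perm ℤ) : Set (ℕ → PWord) :=
  {φ | (∀ n, List.Chain' (· ≤ ·) (φ n)) ∧
    ∃ N, (∀ n, N ≤ n → φ n = []) ∧ ((List.range N).map φ).flatten ∈ RinvPlus z}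

/-- Least bound past which a sequence of words is empty. -/
noncomputable def seqBound (φ : ℕ → PWord) : ℕ := sInf {N | ∀ n, N ≤ n → φ n = []}

/-- The concatenation `a^1 a^2 ⋯` of a sequence of words. -/
noncomputable def concatSeq (φ : ℕ → PWord) : PWord :=
  ((List.range (seqBound φ)).map φ).flatten

/-- `ℓ(a^1) + ⋯ + ℓ(a^i)`. -/
def prefLen (φ : ℕ → PWord) (i : ℕ) : ℕ := (((List.range i).map φ).map List.length).sum

/-- The minimal `i ≥ 1` with `j ≤ ℓ(a^1) + ⋯ + ℓ(a^i)`. -/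
noncomputable def relabel (φ : ℕ → PWord) (j : ℤ) : ℤ :=
  ((sInf {i : ℕ | 1 ≤ i ∧ j ≤ (prefLen φ i : ℤ)} : ℕ) : ℤ)

/-- The semistandard recording tableau `Q_EGᴼ(φ)`. -/
noncomputable def QEGseq (φ : ℕ → PWord) : STab :=
  (QEG (concatSeq φ)).map (List.map (fun x => (⟨relabel φ x.ceil, x.primed⟩ : Letter)))

/-- The insertion tableau `P_EGᴼ(φ)`. -/
noncomputable def PEGseq (φ : ℕ → PWord) : STab := PEG (concatSeq φ)

/-- The Schur Q-function of a strict partition: the coefficient of the monomial with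
exponent vector `d` is the number of semistandard shifted tableaux `T` of the given
shape with `x^T = x^d`. -/
noncomputable def SchurQ (sh : List ℕ) : MvPowerSeries ℤ ℤ :=
  fun d => (({T : STab | shapeOf T = sh ∧ IsSemistandard T ∧
    ∀ i : ℤ, d i = T.flatten.countP (fun x => decide (x.ceil = i))} : Set STab).ncard : ℤ)

/-- `Q_z = Σ_{φ ∈ Incr_∞(R_inv^+(z))} x^φ`. -/
noncomputable def Qz (z : Equiv.Perm ℤ) : MvPowerSeries ℤ ℤ :=
  fun d => (({φ : ℕ → PWord | φ ∈ IncrSeq z ∧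
    (∀ i : ℕ, d ((i : ℤ) + 1) = (φ i).length) ∧
    (∀ j : ℤ, j ≤ 0 → d j = 0)} : Set (ℕ → PWord)).ncard : ℤ)

/-! ## Dominant involutions -/

/-- The shifted diagram `SD_λ ⊆ ℤ × ℤ` of a strict partition. -/
def SDset (sh : List ℕ) : Set (ℤ × ℤ) :=
  {p | ∃ i j : ℕ, 1 ≤ i ∧ i ≤ sh.length ∧ 1 ≤ j ∧ j ≤ sh.getD (i - 1) 0 ∧
    p.1 = (i : ℤ) ∧ p.2 = (i : ℤ) + (j : ℤ) - 1}

/-- The involution Rothe diagram `D̂(z) = {(i,j) : z(i) > j ≤ i < z(j)}`. -/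
def invRothe (z : Equiv.Perm ℤ) : Set (ℤ × ℤ) :=
  {p | p.2 < z p.1 ∧ p.2 ≤ p.1 ∧ p.1 < z p.2}

/-- The tableau `T_λ` with entry `i + j - 1` in box `(i, j)` of `SD_λ`. -/
def Tlam (sh : List ℕ) : STab :=
  (List.range sh.length).map (fun r =>
    (List.range (sh.getD r 0)).map (fun k =>
      (⟨2 * (r : ℤ) + (k : ℤ) + 1, false⟩ : Letter)))

/-- The permutation `i + m ↦ w(i) + m` (fixing everything outside `m + support`). -/
def shiftPerm (m : ℕ) (w : Equiv.Perm ℤ) : Equiv.Perm ℤ :=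
  (Equiv.addLeft (m : ℤ)).permCongr w

/-- `z ∈ S_m`: `z` fixes every point outside `[1, m]`. -/
def SupportedOn (z : Equiv.Perm ℤ) (m : ℕ) : Prop :=
  ∀ x : ℤ, x < 1 ∨ (m : ℤ) < x → z x = x
/-! ## Primed compatible sequences -/

/-- A primed compatible sequence, recorded as the list of its columns `(index; value)`. -/
def IsPrimedCompatible (φ : List (ℕ × Letter)) : Prop :=
  (∀ p ∈ φ, 0 < p.1 ∧ 0 < p.2.ceil) ∧
  List.Chain' (fun p q : ℕ × Letter => p.1 ≤ q.1 ∧ (p.1 = q.1 → p.2 ≤ q.2)) φ ∧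
  (∀ (k l : ℕ) (p : ℕ × Letter), k < l → φ[k]? = some p → φ[l]? = some p →
    p.2.primed = false)

def IsIndexStrict (φ : List (ℕ × Letter)) : Prop :=
  List.Chain' (fun p q : ℕ × Letter => p.1 < q.1) φ

/-! ## Sagan–Worley insertion (orthogonal and symplectic versions) -/

/-- Whether `u` bumps `v`: strict comparison when inserting an unprimed letter into a
row or a primed letter into a column, weak comparison otherwise. -/
def swBump (isRow : Bool) (u v : Letter) : Bool :=
  if (isRow && !u.primed) || (!isRow && u.primed) then decide (u < v) else decide (u ≤ v)

/-- Column stage of orthogonal Sagan–Worley insertion. -/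
def swColO : ℕ → STab → ℕ → Letter → STab × Bool
  | 0, T, _, _ => (T, true)
  | fuel + 1, T, c, u =>
    let occ := (List.range (c + 1)).filterMap (fun r => (entry? T r c).map (fun x => (r, x)))
    match occ.find? (fun p => swBump false u p.2) with
    | none =>
        let r := occ.length
        let u' := if r = c ∧ u.primed then Letter.unprime u else u
        (setRowG T r ((T.getD r []) ++ [u']), true)
    | some p =>
        if p.1 = c then
          if u.ceil = p.2.ceil then swColO fuel T (c + 1) (Letter.unprime p.2)
          else
            let q := switchPrimes u p.2
            swColO fuel (setEntryG T p.1 c q.1) (c + 1) q.2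
        else swColO fuel (setEntryG T p.1 c u) (c + 1) p.2

/-- Row stage of orthogonal Sagan–Worley insertion. -/
def swRowO : ℕ → STab → ℕ → Letter → STab × Bool
  | 0, T, _, _ => (T, true)
  | fuel + 1, T, r, u =>
    let row := T.getD r []
    match row.findIdx? (fun v => swBump true u v) with
    | none =>
        if row.isEmpty ∧ u.primed then (setRowG T r [Letter.unprime u], true)
        else (setRowG T r (row ++ [u]), false)
    | some k =>
        let v := row.getD k default
        if k = 0 then
          if u.ceil = v.ceil then swColO fuel T (r + 1) (Letter.unprime v)
          else
            let q := switchPrimes u v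
            swColO fuel (setRowG T r (row.set 0 q.1)) (r + 1) q.2
        else swRowO fuel (setRowG T r (row.set k u)) (r + 1) v

def swInsertO (T : STab) (u : Letter) : STab × Bool :=
  swRowO (T.flatten.length + T.length + 2) T 0 u

/-- Column stage of symplectic (original) Sagan–Worley insertion. -/
def swColSp : ℕ → STab → ℕ → Letter → STab × Bool
  | 0, T, _, _ => (T, true)
  | fuel + 1, T, c, u =>
    let occ := (List.range (c + 1)).filterMap (fun r => (entry? T r c).map (fun x => (r, x)))
    match occ.find? (fun p => swBump false u p.2) with
    | none => (setRowG T occ.length ((T.getD occ.length []) ++ [u]), true)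
    | some p =>
        if p.1 = c then
          if u.ceil = p.2.ceil then swColSp fuel T (c + 1) (Letter.unprime p.2)
          else swColSp fuel (setEntryG T p.1 c u) (c + 1) p.2
        else swColSp fuel (setEntryG T p.1 c u) (c + 1) p.2

/-- Row stage of symplectic (original) Sagan–Worley insertion. -/
def swRowSp : ℕ → STab → ℕ → Letter → STab × Bool
  | 0, T, _, _ => (T, true)
  | fuel + 1, T, r, u =>
    let row := T.getD r []
    match row.findIdx? (fun v => swBump true u v) with
    | none => (setRowG T r (row ++ [u]), false)
    | some k =>
        let v := row.getD k default
        if k = 0 then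
          if u.ceil = v.ceil then swColSp fuel T (r + 1) (Letter.unprime v)
          else swColSp fuel (setRowG T r (row.set 0 u)) (r + 1) v
        else swRowSp fuel (setRowG T r (row.set k u)) (r + 1) v

def swInsertSp (T : STab) (u : Letter) : STab × Bool :=
  swRowSp (T.flatten.length + T.length + 2) T 0 u

def PSWO (φ : List (ℕ × Letter)) : STab := φ.foldl (fun T p => (swInsertO T p.2).1) []

def PSWSp (φ : List (ℕ × Letter)) : STab := φ.foldl (fun T p => (swInsertSp T p.2).1) []

def QSWaux (ins : STab → Letter → STab × Bool) : STab → STab → List (ℕ × Letter) → STab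
  | _, Q, [] => Q
  | P, Q, p :: rest =>
      let res := ins P p.2
      QSWaux ins res.1 (addBox Q P res.1 ⟨(p.1 : ℤ), res.2⟩) rest

def QSWO (φ : List (ℕ × Letter)) : STab := QSWaux swInsertO [] [] φ

def QSWSp (φ : List (ℕ × Letter)) : STab := QSWaux swInsertSp [] [] φ

/-- Entry `A_{ij}` of the circled matrix of `φ` (forgetting the circles). -/
def cmEntry (φ : List (ℕ × Letter)) (i j : ℕ) : ℕ :=
  φ.countP (fun p => decide (p.1 = i ∧ p.2.ceil = (j : ℤ)))

/-! ## Shifted mixed insertion (orthogonal and symplectic versions) -/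

/-- Tableaux whose entries are signed letters `(ε, u)`, `ε ∈ {+, -}`
(`true` records the sign `-`). -/
abbrev MTab := List (List (Bool × Letter))

def extractO (U : MTab) : STab :=
  U.map (fun row =>
    match row with
    | [] => []
    | (e, x) :: rest => (if e then (⟨x.ceil, true⟩ : Letter) else x) :: rest.map Prod.snd)

def extractSp (U : MTab) : STab := U.map (List.map Prod.snd)

/-- One mixed insertion, of the pair `β` into row (`isCol = false`) or column
(`isCol = true`) number `idx`; returns the tableau and the added box. -/
def hmIns (sympl : Bool) : ℕ → MTab → Bool → ℕ → Bool × Letter → MTab × (ℕ × ℕ)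
  | 0, T, _, _, _ => (T, (0, 0))
  | fuel + 1, T, isCol, idx, β =>
    if isCol then
      let c := idx
      let occ := (List.range (c + 1)).filterMap
        (fun r => (entryG? T r c).map (fun x => (r, x)))
      match occ.find? (fun p => decide (β.2 < p.2.2)) with
      | none =>
          let r := occ.length
          (setRowG T r ((T.getD r []) ++ [β]), (r, c))
      | some p =>
          if p.1 = c then
            hmIns sympl fuel
              (setEntryG T p.1 c (if sympl then (p.2.1, β.2) else β)) true (c + 1)
              (if sympl then (β.1, ⟨p.2.2.ceil, true⟩) else (p.2.1, ⟨p.2.2.ceil, true⟩))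
          else
            hmIns sympl fuel (setEntryG T p.1 c (p.2.1, β.2)) p.2.2.primed
              (if p.2.2.primed then c + 1 else p.1 + 1) (β.1, p.2.2)
    else
      let r := idx
      let row := T.getD r []
      match row.findIdx? (fun p => decide (β.2 < p.2)) with
      | none => (setRowG T r (row ++ [β]), (r, r + row.length))
      | some k =>
          let q := row.getD k default
          if k = 0 then
            hmIns sympl fuel
              (setRowG T r (row.set 0 (if sympl then (q.1, β.2) else β))) true (r + 1)
              (if sympl then (β.1, ⟨q.2.ceil, true⟩) else (q.1, ⟨q.2.ceil, true⟩))
          else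
            hmIns sympl fuel (setRowG T r (row.set k (q.1, β.2))) q.2.primed
              (if q.2.primed then r + k + 1 else r + 1) (β.1, q.2)

def hmInsert (sympl : Bool) (T : MTab) (x : Letter) : MTab × (ℕ × ℕ) :=
  hmIns sympl (2 * T.flatten.length + 4) T false 0 (x.primed, ⟨x.ceil, false⟩)

def hmAuxCS (sympl : Bool) : MTab → STab → List (ℕ × Letter) → MTab × STab
  | U, Q, [] => (U, Q)
  | U, Q, p :: rest =>
      let res := hmInsert sympl U p.2
      let pos := res.2
      let sgn := ((entryG? res.1 pos.1 pos.2).map Prod.fst).getD false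
      let pr : Bool := if sympl then sgn else (decide (pos.1 ≠ pos.2) && sgn)
      hmAuxCS sympl res.1
        (setRowG Q pos.1 ((Q.getD pos.1 []) ++ [(⟨(p.1 : ℤ), pr⟩ : Letter)])) rest

def PHMO (φ : List (ℕ × Letter)) : STab := extractO (hmAuxCS false [] [] φ).1
def QHMO (φ : List (ℕ × Letter)) : STab := (hmAuxCS false [] [] φ).2
def PHMSp (φ : List (ℕ × Letter)) : STab := extractSp (hmAuxCS true [] [] φ).1
def QHMSp (φ : List (ℕ × Letter)) : STab := (hmAuxCS true [] [] φ).2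

/-- A primed word, identified with the primed compatible sequence with
index row `1, 2, …, n`. -/
def wordCS (a : PWord) : List (ℕ × Letter) :=
  ((List.range a.length).zip a).map (fun p => (p.1 + 1, p.2))

/-! ## The transpose of a primed compatible sequence -/

def insSortedCS (p : ℕ × Letter) : List (ℕ × Letter) → List (ℕ × Letter)
  | [] => [p]
  | q :: rest =>
      if p.1 < q.1 ∨ (p.1 = q.1 ∧ p.2 ≤ q.2) then p :: q :: rest
      else q :: insSortedCS p rest

def sortCS (l : List (ℕ × Letter)) : List (ℕ × Letter) := l.foldr insSortedCS []

/-- `φ^⊤`: move each prime from the value to the index above it, interchange the two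
rows, and reorder the columns lexicographically. -/
def transposeCS (φ : List (ℕ × Letter)) : List (ℕ × Letter) :=
  sortCS (φ.map (fun p => (p.2.ceil.toNat, (⟨(p.1 : ℤ), p.2.primed⟩ : Letter))))

/-- One step of the relation `~ᴷ`: `uACBv ∼ uCABv` or `uBCAv ∼ uBACv` for letters
with `⌈A⌉ < ⌈B⌉ < ⌈C⌉`. -/
inductive KStep : PWord → PWord → Prop
  | left (u v : PWord) (A B C : Letter) (h1 : A.ceil < B.ceil) (h2 : B.ceil < C.ceil) :
      KStep (u ++ [A, C, B] ++ v) (u ++ [C, A, B] ++ v)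
  | right (u v : PWord) (A B C : Letter) (h1 : A.ceil < B.ceil) (h2 : B.ceil < C.ceil) :
      KStep (u ++ [B, C, A] ++ v) (u ++ [B, A, C] ++ v)

/-- The equivalence relation `~ᴷ`. -/
def simK : PWord → PWord → Prop := Relation.EqvGen KStep

/-! ## Demazure action on permutations -/

/-- Right Demazure multiplication by `s_i`. -/
def demazureRight (i : ℤ) (σ : Equiv.Perm ℤ) : Equiv.Perm ℤ :=
  if σ i < σ (i + 1) then σ * sPerm i else σ

/-- Left Demazure multiplication by `s_i`. -/
def demazureLeft (i : ℤ) (σ : Equiv.Perm ℤ) : Equiv.Perm ℤ :=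
  (demazureRight i σ⁻¹)⁻¹

/-- Demazure conjugation by `s_i`. -/
def demazureConj (σ : Equiv.Perm ℤ) (i : ℤ) : Equiv.Perm ℤ :=
  demazureLeft i (demazureRight i σ)

/-- Iterated Demazure conjugation of the identity. -/
def conjProd (w : List ℤ) : Equiv.Perm ℤ := w.foldl demazureConj 1

theorem sPerm_left (i : ℤ) : sPerm i i = i + 1 := Equiv.swap_apply_left _ _

theorem sPerm_right (i : ℤ) : sPerm i (i + 1) = i := Equiv.swap_apply_right _ _

theorem sPerm_of_ne {i p : ℤ} (h : p ≠ i) (h' : p ≠ i + 1) : sPerm i p = p :=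
  Equiv.swap_apply_of_ne_of_ne h h'

theorem sPerm_inv (i : ℤ) : (sPerm i)⁻¹ = sPerm i := Equiv.swap_inv _ _

theorem sPerm_sPerm (i p : ℤ) : sPerm i (sPerm i p) = p := Equiv.swap_apply_self _ _ _

theorem sPerm_apply (i p : ℤ) :
    sPerm i p = if p = i then i + 1 else if p = i + 1 then i else p :=
  Equiv.swap_apply_def _ _ _

theorem demazureLeft_eq (i : ℤ) (σ : Equiv.Perm ℤ) :
    demazureLeft i σ = if σ⁻¹ i < σ⁻¹ (i + 1) then sPerm i * σ else σ := by
  unfold demazureLeft demazureRight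
  split_ifs <;> simp [sPerm_inv]

theorem demazureRight_inv (i : ℤ) (σ : Equiv.Perm ℤ) :
    (demazureRight i σ)⁻¹ = demazureLeft i σ⁻¹ := by
  simp [demazureLeft]

theorem demazureLeft_inv (i : ℤ) (σ : Equiv.Perm ℤ) :
    (demazureLeft i σ)⁻¹ = demazureRight i σ⁻¹ := by
  simp [demazureLeft]

theorem demazureLeft_demazureRight_comm (i j : ℤ) (σ : Equiv.Perm ℤ) :
    demazureLeft i (demazureRight j σ) = demazureRight j (demazureLeft i σ) := by
  have hp : σ (σ⁻¹ i) = i := by simp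
  have hq : σ (σ⁻¹ (i + 1)) = i + 1 := by simp
  have ha : σ⁻¹ (σ j) = j := by simp
  have hb : σ⁻¹ (σ (j + 1)) = j + 1 := by simp
  have inj : ∀ x y, σ x = σ y → x = y := fun x y h => σ.injective h
  have hnex : σ j ≠ σ (j + 1) := fun h => by have := inj _ _ h; omega
  rw [demazureLeft_eq, demazureLeft_eq]
  unfold demazureRight
  by_cases h1 : σ j < σ (j + 1) <;> by_cases h2 : σ⁻¹ i < σ⁻¹ (i + 1)
  · have e1 : (σ * sPerm j)⁻¹ i = sPerm j (σ⁻¹ i) := by simp [sPerm_inv]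
    have e2 : (σ * sPerm j)⁻¹ (i + 1) = sPerm j (σ⁻¹ (i + 1)) := by simp [sPerm_inv]
    have e3 : (sPerm i * σ) j = sPerm i (σ j) := rfl
    have e4 : (sPerm i * σ) (j + 1) = sPerm i (σ (j + 1)) := rfl
    simp only [h1, h2, if_true, e1, e2, e3, e4]
    by_cases hc : σ j = i ∧ σ (j + 1) = i + 1
    · have e5 : σ⁻¹ i = j := by rw [← hc.1]; exact ha
      have e6 : σ⁻¹ (i + 1) = j + 1 := by rw [← hc.2]; exact hb
      rw [e5, e6, hc.1, hc.2, sPerm_left, sPerm_right, sPerm_left, sPerm_right]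
      rw [if_neg (by omega), if_neg (by omega)]
      ext x
      simp only [Equiv.Perm.mul_apply, sPerm_apply]
      have := inj x j
      have := inj x (j + 1)
      split_ifs <;> grind
    · have c1 : sPerm j (σ⁻¹ i) < sPerm j (σ⁻¹ (i + 1)) := by
        simp only [sPerm_apply]; split_ifs <;> grind
      have c2 : sPerm i (σ j) < sPerm i (σ (j + 1)) := by
        simp only [sPerm_apply]; split_ifs <;> grind
      rw [if_pos c1, if_pos c2, mul_assoc]
  · have e1 : (σ * sPerm j)⁻¹ i = sPerm j (σ⁻¹ i) := by simp [sPerm_inv]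
    have e2 : (σ * sPerm j)⁻¹ (i + 1) = sPerm j (σ⁻¹ (i + 1)) := by simp [sPerm_inv]
    simp only [h1, h2, if_true, if_false, e1, e2]
    rw [if_neg]
    simp only [sPerm_apply]; split_ifs <;> grind
  · have e3 : (sPerm i * σ) j = sPerm i (σ j) := rfl
    have e4 : (sPerm i * σ) (j + 1) = sPerm i (σ (j + 1)) := rfl
    simp only [h1, h2, if_true, if_false, e3, e4]
    rw [if_neg]
    simp only [sPerm_apply]; split_ifs <;> grind
  · simp only [h1, h2, if_false]

theorem heckeProd_append_singleton (w : List ℤ) (i : ℤ) :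
    heckeProd (w ++ [i]) = demazureRight i (heckeProd w) := by
  rw [heckeProd, List.foldl_append]
  rfl

theorem heckeProd_cons (i : ℤ) (w : List ℤ) :
    heckeProd (i :: w) = demazureLeft i (heckeProd w) := by
  induction w using List.reverseRecOn with
  | nil => simp [heckeProd, demazureLeft_eq]
  | append_singleton w j ih =>
    rw [← List.cons_append, heckeProd_append_singleton, ih, heckeProd_append_singleton,
      demazureLeft_demazureRight_comm]

theorem conjProd_append_singleton (w : List ℤ) (i : ℤ) :
    conjProd (w ++ [i]) = demazureConj (conjProd w) i := by
  simp [conjProd]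

theorem conjProd_append (u v : List ℤ) :
    conjProd (u ++ v) = v.foldl demazureConj (conjProd u) := by
  simp [conjProd]

theorem conjProd_singleton (i : ℤ) : conjProd [i] = sPerm i := by
  simp [conjProd, demazureConj, demazureLeft_eq, demazureRight, sPerm_inv, sPerm_left,
    sPerm_right]

theorem invHecke_eq_conjProd (a : List ℤ) : invHecke a = conjProd a := by
  cases a with
  | nil => rfl
  | cons x w =>
    induction w using List.reverseRecOn with
    | nil => rw [conjProd_singleton]; simp [invHecke, heckeProd]
    | append_singleton w j ih =>
      rw [← List.cons_append, conjProd_append_singleton, ← ih, demazureConj, invHecke, invHecke,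
        ← heckeProd_append_singleton, ← heckeProd_cons]
      simp

theorem demazureConj_inv (σ : Equiv.Perm ℤ) (i : ℤ) :
    (demazureConj σ i)⁻¹ = demazureConj σ⁻¹ i := by
  rw [demazureConj, demazureLeft_inv, demazureRight_inv, demazureConj,
    demazureLeft_demazureRight_comm]

theorem conjProd_inv (w : List ℤ) : (conjProd w)⁻¹ = conjProd w := by
  induction w using List.reverseRecOn with
  | nil => simp [conjProd]
  | append_singleton w j ih => rw [conjProd_append_singleton, demazureConj_inv, ih]

theorem demazureConj_descent (σ : Equiv.Perm ℤ) (i : ℤ) :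
    demazureConj σ i (i + 1) < demazureConj σ i i := by
  rw [demazureConj, demazureLeft_demazureRight_comm]
  generalize demazureLeft i σ = τ
  have : τ i ≠ τ (i + 1) := fun h => by have := τ.injective h; omega
  unfold demazureRight
  split_ifs with h
  · simpa [sPerm_left, sPerm_right] using h
  · omega

theorem demazureConj_conjProd_of_descent {w : List ℤ} {i : ℤ}
    (h : ¬ conjProd w i < conjProd w (i + 1)) : demazureConj (conjProd w) i = conjProd w := by
  have h' : ¬ (conjProd w)⁻¹ i < (conjProd w)⁻¹ (i + 1) := by rwa [conjProd_inv]
  rw [demazureConj, demazureRight, if_neg h, demazureLeft_eq, if_neg h']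

theorem demazureConj_apply_eq_iff (σ : Equiv.Perm ℤ) {i p q : ℤ} (hp : p ≠ i)
    (hp' : p ≠ i + 1) (hq : q ≠ i) (hq' : q ≠ i + 1) :
    demazureConj σ i p = q ↔ σ p = q := by
  have h1 : demazureRight i σ p = σ p := by
    unfold demazureRight
    split_ifs
    · simp [sPerm_of_ne hp hp']
    · rfl
  rw [demazureConj, demazureLeft_eq]
  split_ifs
  · rw [Equiv.Perm.mul_apply, h1]
    constructor
    · intro h
      rw [← sPerm_sPerm i (σ p), h, sPerm_of_ne hq hq']
    · rintro rfl
      exact sPerm_of_ne hq hq'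
  · rw [h1]

theorem foldl_demazureConj_apply_eq_iff (w : List ℤ) (σ : Equiv.Perm ℤ) {p q : ℤ}
    (h : ∀ x ∈ w, p ≠ x ∧ p ≠ x + 1 ∧ q ≠ x ∧ q ≠ x + 1) :
    w.foldl demazureConj σ p = q ↔ σ p = q := by
  induction w generalizing σ with
  | nil => rfl
  | cons x w ih =>
    obtain ⟨h1, h2, h3, h4⟩ := h x (by simp)
    rw [List.foldl_cons, ih _ (fun y hy => h y (by simp [hy])),
      demazureConj_apply_eq_iff σ h1 h2 h3 h4]

theorem demazureConj_of_fixed {σ : Equiv.Perm ℤ} {i : ℤ} (h : σ i = i)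
    (h' : σ (i + 1) = i + 1) : demazureConj σ i = σ * sPerm i := by
  have e : (σ * sPerm i)⁻¹ i = i + 1 := by
    rw [Equiv.Perm.inv_eq_iff_eq]; simp [sPerm_right, h]
  have e' : (σ * sPerm i)⁻¹ (i + 1) = i := by
    rw [Equiv.Perm.inv_eq_iff_eq]; simp [sPerm_left, h']
  rw [demazureConj, demazureRight, if_pos (by omega), demazureLeft_eq, e, e',
    if_neg (by omega)]

theorem demazureConj_of_fixed_left {σ : Equiv.Perm ℤ} {i : ℤ} (h : σ i = i)
    (h' : σ (i + 1) = i + 1) : demazureConj σ i i = i + 1 := by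
  simp [demazureConj_of_fixed h h', sPerm_left, h']

theorem demazureConj_of_fixed_right {σ : Equiv.Perm ℤ} {i : ℤ} (h : σ i = i)
    (h' : σ (i + 1) = i + 1) : demazureConj σ i (i + 1) = i := by
  simp [demazureConj_of_fixed h h', sPerm_right, h]

theorem demazureRight_comm {i j : ℤ} (h : i + 1 < j) (σ : Equiv.Perm ℤ) :
    demazureRight i (demazureRight j σ) = demazureRight j (demazureRight i σ) := by
  have e1 : sPerm j i = i := sPerm_of_ne (by omega) (by omega)
  have e2 : sPerm j (i + 1) = i + 1 := sPerm_of_ne (by omega) (by omega)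
  have e3 : sPerm i j = j := sPerm_of_ne (by omega) (by omega)
  have e4 : sPerm i (j + 1) = j + 1 := sPerm_of_ne (by omega) (by omega)
  have e5 : sPerm j * sPerm i = sPerm i * sPerm j := by
    ext x
    simp only [Equiv.Perm.mul_apply, sPerm_apply]
    split_ifs <;> omega
  unfold demazureRight
  by_cases h1 : σ i < σ (i + 1) <;> by_cases h2 : σ j < σ (j + 1) <;>
    simp [h1, h2, e1, e2, e3, e4, mul_assoc, e5]

theorem demazureLeft_comm {i j : ℤ} (h : i + 1 < j) (σ : Equiv.Perm ℤ) :
    demazureLeft i (demazureLeft j σ) = demazureLeft j (demazureLeft i σ) := by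
  simp [demazureLeft, demazureRight_comm h]

theorem demazureConj_comm {i j : ℤ} (h : i + 1 < j) (σ : Equiv.Perm ℤ) :
    demazureConj (demazureConj σ j) i = demazureConj (demazureConj σ i) j := by
  simp only [demazureConj]
  rw [← demazureLeft_demazureRight_comm j i, demazureLeft_comm h, demazureRight_comm h,
    demazureLeft_demazureRight_comm i j]

theorem conjProd_swap {i j : ℤ} (h : i + 1 < j) (u v : List ℤ) :
    conjProd (u ++ i :: j :: v) = conjProd (u ++ j :: i :: v) := by
  simp only [conjProd_append, List.foldl_cons, demazureConj_comm h]

/-! ## Primed involution words -/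

theorem RinvPlus.ascent {z : Equiv.Perm ℤ} {u v : PWord} {x : Letter}
    (h : u ++ x :: v ∈ RinvPlus z) :
    conjProd (unprimeWord u) x.ceil < conjProd (unprimeWord u) (x.ceil + 1) := by
  by_contra hc
  have key : invHecke (unprimeWord (u ++ v)) = z := by
    rw [← h.1.1, invHecke_eq_conjProd, invHecke_eq_conjProd]
    simp [unprimeWord, conjProd_append]
    rw [← unprimeWord, demazureConj_conjProd_of_descent hc]
  have := h.1.2 _ key
  simp [unprimeWord] at this

theorem RinvPlus.fixed {z : Equiv.Perm ℤ} {u v : PWord} {x : Letter}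
    (h : u ++ x :: v ∈ RinvPlus z) (hx : x.primed = true) :
    conjProd (unprimeWord u) x.ceil = x.ceil ∧
      conjProd (unprimeWord u) (x.ceil + 1) = x.ceil + 1 := by
  obtain ⟨y, h1, h2, h3⟩ := h.2 u.length x (by simp) hx
  have hy : y = x.ceil := by simpa [unprimeWord] using h1.symm
  subst hy
  have ht : (unprimeWord (u ++ x :: v)).take u.length = unprimeWord u := by
    simp [unprimeWord]
  rw [ht, invHecke_eq_conjProd] at h2 h3
  exact ⟨h2, h3⟩

theorem RinvPlus.ceil_ne {z : Equiv.Perm ℤ} {u v : PWord} {x y : Letter}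
    (h : u ++ x :: y :: v ∈ RinvPlus z) : x.ceil ≠ y.ceil := by
  intro hxy
  have h1 : (u ++ [x]) ++ y :: v ∈ RinvPlus z := by simpa using h
  have h2 := RinvPlus.ascent h1
  have h3 : unprimeWord (u ++ [x]) = unprimeWord u ++ [x.ceil] := by simp [unprimeWord]
  rw [h3, conjProd_append_singleton, ← hxy] at h2
  have := demazureConj_descent (conjProd (unprimeWord u)) x.ceil
  omega

theorem RinvPlus.of_fixed {z : Equiv.Perm ℤ} {a : PWord} (h : unprimeWord a ∈ Rinv z)
    (hp : ∀ u v x, a = u ++ x :: v → x.primed = true →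
      conjProd (unprimeWord u) x.ceil = x.ceil ∧
        conjProd (unprimeWord u) (x.ceil + 1) = x.ceil + 1) : a ∈ RinvPlus z := by
  refine ⟨h, fun k x hk hx => ⟨x.ceil, by simp [unprimeWord, hk], ?_⟩⟩
  obtain ⟨hlt, hget⟩ := List.getElem?_eq_some_iff.1 hk
  have ha : a = a.take k ++ x :: a.drop (k + 1) := by
    rw [← hget, ← List.drop_eq_getElem_cons hlt, List.take_append_drop]
  have ht : (unprimeWord a).take k = unprimeWord (a.take k) := by simp [unprimeWord]
  rw [ht, invHecke_eq_conjProd]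
  exact hp _ _ _ ha hx

theorem RinvPlus.swap {z : Equiv.Perm ℤ} {u v : PWord} {x y : Letter}
    (hxy : x.ceil + 1 < y.ceil ∨ y.ceil + 1 < x.ceil) (h : u ++ x :: y :: v ∈ RinvPlus z) :
    u ++ y :: x :: v ∈ RinvPlus z := by
  have hprod : ∀ t : PWord,
      conjProd (unprimeWord (u ++ y :: x :: t)) = conjProd (unprimeWord (u ++ x :: y :: t)) := by
    intro t
    simp only [unprimeWord, List.map_append, List.map_cons]
    rcases hxy with hxy | hxy
    · rw [conjProd_swap hxy]
    · rw [conjProd_swap hxy]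
  refine RinvPlus.of_fixed ⟨?_, ?_⟩ ?_
  · rw [← h.1.1, invHecke_eq_conjProd, invHecke_eq_conjProd, hprod]
  · intro b hb
    have := h.1.2 b hb
    simpa [unprimeWord] using this
  · intro u' v' w hw hwp
    have hsing : ∀ s : Letter, conjProd (unprimeWord (u ++ [s])) =
        demazureConj (conjProd (unprimeWord u)) s.ceil := fun s => by
      simp [unprimeWord, conjProd_append]
    rcases List.append_eq_append_iff.1 hw with ⟨t, h1, h2⟩ | ⟨t, h1, h2⟩
    · rcases t with _ | ⟨t1, _ | ⟨t2, t⟩⟩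
      · simp only [List.nil_append, List.cons.injEq] at h2
        obtain ⟨rfl, rfl⟩ := h2
        have h' : (u ++ [x]) ++ y :: v ∈ RinvPlus z := by simpa using h
        have := RinvPlus.fixed h' hwp
        rw [hsing, demazureConj_apply_eq_iff _ (by omega) (by omega) (by omega) (by omega),
          demazureConj_apply_eq_iff _ (by omega) (by omega) (by omega) (by omega)] at this
        simpa [h1] using this
      · simp only [List.cons_append, List.nil_append, List.cons.injEq] at h2
        obtain ⟨rfl, rfl, rfl⟩ := h2
        have := RinvPlus.fixed h hwp
        rw [h1, hsing, demazureConj_apply_eq_iff _ (by omega) (by omega) (by omega) (by omega),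
          demazureConj_apply_eq_iff _ (by omega) (by omega) (by omega) (by omega)]
        exact this
      · simp only [List.cons_append, List.cons.injEq] at h2
        obtain ⟨rfl, rfl, rfl⟩ := h2
        subst h1
        rw [hprod]
        exact RinvPlus.fixed (v := v') (by simpa using h) hwp
    · rcases t with _ | ⟨t1, t⟩
      · simp only [List.nil_append, List.cons.injEq] at h2
        obtain ⟨rfl, rfl⟩ := h2
        have h' : (u ++ [x]) ++ w :: v ∈ RinvPlus z := by simpa using h
        have := RinvPlus.fixed h' hwp
        rw [hsing, demazureConj_apply_eq_iff _ (by omega) (by omega) (by omega) (by omega),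
          demazureConj_apply_eq_iff _ (by omega) (by omega) (by omega) (by omega)] at this
        simpa [h1] using this
      · simp only [List.cons_append, List.cons.injEq] at h2
        obtain ⟨rfl, rfl⟩ := h2
        subst h1
        exact RinvPlus.fixed (v := t ++ x :: y :: v) (by simpa using h) hwp

theorem KStep.mem_RinvPlus_iff {a b : PWord} (h : KStep a b) (z : Equiv.Perm ℤ) :
    a ∈ RinvPlus z ↔ b ∈ RinvPlus z := by
  cases h with
  | left u v A B C h1 h2 =>
    simp only [List.append_assoc, List.cons_append, List.nil_append]
    exact ⟨RinvPlus.swap (Or.inl (by omega)), RinvPlus.swap (Or.inr (by omega))⟩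
  | right u v A B C h1 h2 =>
    have h3 := @RinvPlus.swap z (u ++ [B]) v C A (Or.inr (by omega))
    have h4 := @RinvPlus.swap z (u ++ [B]) v A C (Or.inl (by omega))
    simp only [List.append_assoc, List.cons_append, List.nil_append] at h3 h4 ⊢
    exact ⟨h3, h4⟩

theorem simK.mem_RinvPlus_iff {a b : PWord} (h : simK a b) (z : Equiv.Perm ℤ) :
    a ∈ RinvPlus z ↔ b ∈ RinvPlus z := by
  induction h with
  | rel _ _ h => exact h.mem_RinvPlus_iff z
  | refl => rfl
  | symm _ _ _ ih => exact ih.symm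
  | trans _ _ _ _ _ ih1 ih2 => exact ih1.trans ih2

/-! ## Moving a column past a row -/

theorem simK.refl (a : PWord) : simK a a := Relation.EqvGen.refl a

theorem simK.trans {a b c : PWord} (h : simK a b) (h' : simK b c) : simK a c :=
  Relation.EqvGen.trans _ _ _ h h'

theorem KStep.append {a b : PWord} (h : KStep a b) (p q : PWord) :
    KStep (p ++ a ++ q) (p ++ b ++ q) := by
  cases h with
  | left u v A B C h1 h2 =>
    have := KStep.left (p ++ u) (v ++ q) A B C h1 h2
    simpa only [List.append_assoc] using this
  | right u v A B C h1 h2 =>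
    have := KStep.right (p ++ u) (v ++ q) A B C h1 h2
    simpa only [List.append_assoc] using this

theorem simK.append {a b : PWord} (h : simK a b) (p q : PWord) :
    simK (p ++ a ++ q) (p ++ b ++ q) := by
  induction h with
  | rel _ _ h => exact Relation.EqvGen.rel _ _ (h.append p q)
  | refl => exact simK.refl _
  | symm _ _ _ ih => exact Relation.EqvGen.symm _ _ ih
  | trans _ _ _ _ _ ih1 ih2 => exact ih1.trans ih2

theorem simK_letter_past_row (c b : Letter) (hc : b.ceil < c.ceil) (t : PWord)
    (ht : (t ++ [b]).Pairwise (fun x y => x.ceil < y.ceil)) :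
    simK (c :: t ++ [b]) (t ++ [c, b]) := by
  induction t with
  | nil => exact simK.refl _
  | cons x t ih =>
    have hx : x.ceil < b.ceil := (List.pairwise_cons.1 ht).1 b (by simp)
    have ih' := (ih (List.pairwise_cons.1 ht).2).append [x] []
    simp only [List.cons_append, List.nil_append, List.append_nil] at ih' ⊢
    refine simK.trans ?_ ih'
    refine Relation.EqvGen.symm _ _ (Relation.EqvGen.rel _ _ ?_)
    rcases t with _ | ⟨y, t⟩
    · exact KStep.left [] [] x b c hx hc
    · have hxy : x.ceil < y.ceil := (List.pairwise_cons.1 ht).1 y (by simp)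
      have hyb : y.ceil < b.ceil :=
        (List.pairwise_cons.1 (List.pairwise_cons.1 ht).2).1 b (by simp)
      simpa using KStep.left [] (t ++ [b]) x y c hxy (by omega)

theorem simK_column_past_row (C : PWord) (b : Letter) (t : PWord)
    (hC : (C ++ [b]).Pairwise (fun x y => y.ceil < x.ceil))
    (ht : (t ++ [b]).Pairwise (fun x y => x.ceil < y.ceil)) :
    simK (C ++ t ++ [b]) (t ++ C ++ [b]) := by
  induction C with
  | nil => simpa using simK.refl (t ++ [b])
  | cons c C ih =>
    have ih' := (ih (List.pairwise_cons.1 hC).2).append [c] []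
    simp only [List.cons_append, List.nil_append, List.append_nil] at ih' ⊢
    refine ih'.trans ?_
    have hgt := (List.pairwise_cons.1 hC).1
    rcases C with _ | ⟨d, C⟩
    · simpa using simK_letter_past_row c b (hgt b (by simp)) t ht
    · have hdb : b.ceil < d.ceil :=
        (List.pairwise_cons.1 (List.pairwise_cons.1 hC).2).1 b (by simp)
      have hd : (t ++ [d]).Pairwise (fun x y => x.ceil < y.ceil) := by
        rw [List.pairwise_append] at ht ⊢
        refine ⟨ht.1, by simp, fun x hx y hy => ?_⟩
        have := ht.2.2 x hx b (by simp)
        simp only [List.mem_singleton] at hy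
        subst hy
        omega
      have := (simK_letter_past_row c d (hgt d (by simp)) t hd).append [] (C ++ [b])
      simpa using this

/-- Interleaving columns `D 0, D 1, …` with the letters of a row below and to their left. -/
theorem simK_columns_row (D : ℕ → PWord) (R : PWord)
    (hR : R.Pairwise (fun x y => x.ceil < y.ceil))
    (hD : ∀ j b, R[j + 1]? = some b → (D j ++ [b]).Pairwise (fun x y => y.ceil < x.ceil))
    (j : ℕ) (hj : j < R.length) :
    simK ((List.range j).flatMap D ++ R.take (j + 1))
      (R.take 1 ++ (List.range j).flatMap (fun c => D c ++ R[c + 1]?.toList)) := by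
  induction j with
  | zero => simpa using simK.refl _
  | succ j ih =>
    have hb : R[j + 1]? = some R[j + 1] := List.getElem?_eq_getElem hj
    have htake : R.take (j + 1 + 1) = R.take (j + 1) ++ [R[j + 1]] := by
      rw [List.take_add_one, hb]; rfl
    have hinc : (R.take (j + 1) ++ [R[j + 1]]).Pairwise (fun x y => x.ceil < y.ceil) := by
      rw [← htake]; exact hR.sublist (List.take_sublist _ _)
    have h1 := (simK_column_past_row (D j) R[j + 1] (R.take (j + 1)) (hD j _ hb) hinc).append
      ((List.range j).flatMap D) []
    have h2 := (ih (by omega)).append [] (D j ++ [R[j + 1]])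
    rw [htake]
    simp only [List.range_succ, List.flatMap_append, List.flatMap_cons, List.flatMap_nil, hb,
      Option.toList_some, List.append_nil, List.nil_append, List.append_assoc] at h1 h2 ⊢
    exact h1.trans h2

/-! ## Shifted tableaux -/

theorem entry?_eq_some {T : STab} {r c : ℕ} {x : Letter} :
    entry? T r c = some x ↔ r ≤ c ∧ ∃ R, T[r]? = some R ∧ R[c - r]? = some x := by
  unfold entry? entryG?
  split_ifs with h <;> simp [h, Option.bind_eq_some_iff]

theorem entry?_row {T : STab} {r c : ℕ} {x : Letter} (h : entry? T r c = some x) : r ≤ c :=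
  (entry?_eq_some.1 h).1

theorem IsShifted.length_lt {T : STab} (hT : IsShifted T) {r : ℕ} {R R' : List Letter}
    (h : T[r]? = some R) (h' : T[r + 1]? = some R') : R'.length < R.length := by
  have h1 := hT.1
  have e : (shapeOf T)[r]? = some R.length := by simp [shapeOf, h]
  have e' : (shapeOf T)[r + 1]? = some R'.length := by simp [shapeOf, h']
  obtain ⟨hl, he⟩ := List.getElem?_eq_some_iff.1 e
  obtain ⟨hl', he'⟩ := List.getElem?_eq_some_iff.1 e'
  have := List.isChain_iff_getElem.1 h1 r hl'
  omega

theorem IsShifted.tail {R : List Letter} {T : STab} (hT : IsShifted (R :: T)) : IsShifted T :=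
  ⟨List.IsChain.tail hT.1, fun m hm => hT.2 m (List.mem_cons_of_mem _ hm)⟩

theorem IsShifted.entry?_below {T : STab} (hT : IsShifted T) {r c : ℕ} {y : Letter}
    (h : entry? T (r + 1) c = some y) : ∃ x, entry? T r c = some x := by
  obtain ⟨hrc, R', h1, h2⟩ := entry?_eq_some.1 h
  obtain ⟨hl', -⟩ := List.getElem?_eq_some_iff.1 h1
  obtain ⟨hk, -⟩ := List.getElem?_eq_some_iff.1 h2
  have hR : T[r]? = some T[r] := List.getElem?_eq_getElem (by omega)
  have := hT.length_lt hR h1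
  have hlt : c - r < T[r].length := by omega
  exact ⟨T[r][c - r], entry?_eq_some.2 ⟨by omega, _, hR, List.getElem?_eq_getElem hlt⟩⟩

theorem entry?_left {T : STab} {r c c' : ℕ} {y : Letter} (hrc : r ≤ c) (hc : c ≤ c')
    (h : entry? T r c' = some y) : ∃ x, entry? T r c = some x := by
  obtain ⟨-, R, h1, h2⟩ := entry?_eq_some.1 h
  obtain ⟨hk, -⟩ := List.getElem?_eq_some_iff.1 h2
  have hlt : c - r < R.length := by omega
  exact ⟨R[c - r], entry?_eq_some.2 ⟨hrc, R, h1, List.getElem?_eq_getElem hlt⟩⟩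

theorem IsShifted.entry?_below_of_le {T : STab} (hT : IsShifted T) {r r' c : ℕ} (hr : r ≤ r')
    {y : Letter} (h : entry? T r' c = some y) : ∃ x, entry? T r c = some x := by
  induction r', hr using Nat.le_induction generalizing y with
  | base => exact ⟨y, h⟩
  | succ r' _ ih =>
    obtain ⟨x, hx⟩ := hT.entry?_below h
    exact ih hx

theorem row_rel_of_adjacent {T : STab} {P : Letter → Letter → Prop}
    (htrans : ∀ x y z, P x y → P y z → P x z)
    (hP : ∀ r c x y, entry? T r c = some x → entry? T r (c + 1) = some y → P x y)
    {r c c' : ℕ} (hc : c < c') {x y : Letter} (hx : entry? T r c = some x)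
    (hy : entry? T r c' = some y) : P x y := by
  induction c', hc using Nat.le_induction generalizing y with
  | base => exact hP _ _ _ _ hx hy
  | succ c' hc ih =>
    obtain ⟨w, hw⟩ := entry?_left (c := c') (by have := entry?_row hx; omega) (by omega) hy
    exact htrans _ _ _ (ih hw) (hP _ _ _ _ hw hy)

theorem IsShifted.col_rel_of_adjacent {T : STab} (hT : IsShifted T)
    {P : Letter → Letter → Prop} (htrans : ∀ x y z, P x y → P y z → P x z)
    (hP : ∀ r c x y, entry? T r c = some x → entry? T (r + 1) c = some y → P x y)
    {r r' c : ℕ} (hr : r < r') {x y : Letter} (hx : entry? T r c = some x)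
    (hy : entry? T r' c = some y) : P x y := by
  induction r', hr using Nat.le_induction generalizing y with
  | base => exact hP _ _ _ _ hx hy
  | succ r' hr ih =>
    obtain ⟨w, hw⟩ := hT.entry?_below hy
    exact htrans _ _ _ (ih hw) (hP _ _ _ _ hw hy)

theorem Letter.lt_iff {x y : Letter} :
    x < y ↔ x.ceil < y.ceil ∨ x.ceil = y.ceil ∧ x.primed = true ∧ y.primed = false := by
  have h : x < y ↔ toLex (x.ceil, !x.primed) < toLex (y.ceil, !y.primed) := Iff.rfl
  rw [h, Prod.Lex.toLex_lt_toLex]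
  cases x.primed <;> cases y.primed <;> simp

theorem Letter.ceil_le_of_lt {x y : Letter} (h : x < y) : x.ceil ≤ y.ceil := by
  rcases Letter.lt_iff.1 h with h | h <;> omega

theorem IsIncreasing.ceil_le {T : STab} (hT : IsShifted T) (h : IsIncreasing T)
    {r r' c c' : ℕ} (hr : r ≤ r') (hc : c ≤ c') {x y : Letter} (hx : entry? T r c = some x)
    (hy : entry? T r' c' = some y) : x.ceil ≤ y.ceil := by
  obtain ⟨w, hw⟩ := hT.entry?_below_of_le hr hy
  have h1 : x.ceil ≤ w.ceil := by
    rcases hc.eq_or_lt with rfl | hc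
    · have : x = w := Option.some_injective _ (hx.symm.trans hw)
      rw [this]
    · exact Letter.ceil_le_of_lt
        (row_rel_of_adjacent (P := (· < ·)) (fun _ _ _ => lt_trans) h.1 hc hx hw)
  have h2 : w.ceil ≤ y.ceil := by
    rcases hr.eq_or_lt with rfl | hr
    · have : y = w := Option.some_injective _ (hy.symm.trans hw)
      rw [this]
    · exact Letter.ceil_le_of_lt
        (hT.col_rel_of_adjacent (P := (· < ·)) (fun _ _ _ => lt_trans) h.2 hr hw hy)
  omega

/-- Rows have strictly increasing ceilings. -/
def RowStrict (T : STab) : Prop :=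
  ∀ r c x y, entry? T r c = some x → entry? T r (c + 1) = some y → x.ceil < y.ceil

/-- Columns have strictly increasing ceilings. -/
def ColStrict (T : STab) : Prop :=
  ∀ r c x y, entry? T r c = some x → entry? T (r + 1) c = some y → x.ceil < y.ceil

theorem entry?_unprimeT (T : STab) (r c : ℕ) :
    entry? (unprimeT T) r c = (entry? T r c).map Letter.unprime := by
  unfold entry? entryG? unprimeT
  split_ifs
  · rw [List.getElem?_map]
    cases T[r]? <;> simp
  · rfl

theorem Letter.unprime_lt_iff {x y : Letter} : x.unprime < y.unprime ↔ x.ceil < y.ceil := by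
  simp [Letter.lt_iff, Letter.unprime]

theorem isIncreasing_unprimeT_iff (T : STab) :
    IsIncreasing (unprimeT T) ↔ RowStrict T ∧ ColStrict T := by
  simp only [IsIncreasing, entry?_unprimeT, Option.map_eq_some_iff, RowStrict, ColStrict]
  constructor
  · exact fun h => ⟨fun r c x y hx hy => Letter.unprime_lt_iff.1
      (h.1 r c _ _ ⟨x, hx, rfl⟩ ⟨y, hy, rfl⟩), fun r c x y hx hy => Letter.unprime_lt_iff.1
      (h.2 r c _ _ ⟨x, hx, rfl⟩ ⟨y, hy, rfl⟩)⟩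
  · rintro ⟨h1, h2⟩
    refine ⟨?_, ?_⟩
    · rintro r c _ _ ⟨x, hx, rfl⟩ ⟨y, hy, rfl⟩
      exact Letter.unprime_lt_iff.2 (h1 _ _ _ _ hx hy)
    · rintro r c _ _ ⟨x, hx, rfl⟩ ⟨y, hy, rfl⟩
      exact Letter.unprime_lt_iff.2 (h2 _ _ _ _ hx hy)

/-! ## Columns of a shifted tableau -/

/-- Column `c` read from top to bottom. -/
def colDown (T : STab) (c : ℕ) : PWord :=
  (List.range (c + 1)).reverse.filterMap (fun r => entry? T r c)

theorem colWord_eq (T : STab) : colWord T = (List.range (numCols T)).flatMap (colDown T) := rfl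

theorem mem_colDown {T : STab} {c : ℕ} {x : Letter} :
    x ∈ colDown T c ↔ ∃ r, entry? T r c = some x := by
  simp only [colDown, List.mem_filterMap, List.mem_reverse, List.mem_range]
  exact ⟨fun ⟨r, _, h⟩ => ⟨r, h⟩, fun ⟨r, h⟩ => ⟨r, by have := entry?_row h; omega, h⟩⟩

theorem IsShifted.lt_numCols {T : STab} (hT : IsShifted T) {r c : ℕ} {x : Letter}
    (h : entry? T r c = some x) : c < numCols T := by
  obtain ⟨y, hy⟩ := hT.entry?_below_of_le (Nat.zero_le r) h
  obtain ⟨-, R, h1, h2⟩ := entry?_eq_some.1 hy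
  obtain ⟨hk, -⟩ := List.getElem?_eq_some_iff.1 h2
  simpa [numCols, List.getD_eq_getElem?_getD, h1] using hk

theorem IsShifted.colDown_eq_nil {T : STab} (hT : IsShifted T) {c : ℕ} (hc : numCols T ≤ c) :
    colDown T c = [] := by
  rw [List.eq_nil_iff_forall_not_mem]
  intro x hx
  obtain ⟨r, hr⟩ := mem_colDown.1 hx
  have := hT.lt_numCols hr
  omega

theorem entry?_cons_succ (R : List Letter) (T : STab) (r c : ℕ) :
    entry? (R :: T) (r + 1) (c + 1) = entry? T r c := by
  simp [entry?, entryG?]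

theorem entry?_cons_zero (R : List Letter) (T : STab) (c : ℕ) :
    entry? (R :: T) 0 c = R[c]? := by
  simp [entry?, entryG?]

theorem colDown_cons_zero (R : List Letter) (T : STab) :
    colDown (R :: T) 0 = R.take 1 := by
  rw [List.take_one]
  cases R <;> simp [colDown, entry?_cons_zero]

theorem colDown_cons_succ (R : List Letter) (T : STab) (c : ℕ) :
    colDown (R :: T) (c + 1) = colDown T c ++ R[c + 1]?.toList := by
  unfold colDown
  rw [List.range_succ_eq_map, List.reverse_cons, List.filterMap_append, ← List.map_reverse,
    List.filterMap_map]
  simp only [Function.comp_def, Nat.succ_eq_add_one, entry?_cons_succ, List.filterMap_cons,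
    entry?_cons_zero]
  cases R[c + 1]? <;> simp

theorem IsShifted.colDown_pairwise {T : STab} (hT : IsShifted T) (hc : ColStrict T) (c : ℕ) :
    (colDown T c).Pairwise (fun x y => y.ceil < x.ceil) := by
  unfold colDown
  rw [List.pairwise_filterMap, List.pairwise_reverse]
  refine List.Pairwise.imp ?_ List.pairwise_lt_range
  intro r r' hr y hy x hx
  exact hT.col_rel_of_adjacent (P := fun x y => x.ceil < y.ceil) (fun _ _ _ => lt_trans) hc hr hx hy

theorem RowStrict.tail {R : List Letter} {T : STab} (h : RowStrict (R :: T)) : RowStrict T :=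
  fun r c x y hx hy => h (r + 1) (c + 1) x y (by rwa [entry?_cons_succ])
    (by rwa [entry?_cons_succ])

theorem ColStrict.tail {R : List Letter} {T : STab} (h : ColStrict (R :: T)) : ColStrict T :=
  fun r c x y hx hy => h (r + 1) (c + 1) x y (by rwa [entry?_cons_succ])
    (by rwa [entry?_cons_succ])

theorem RowStrict.pairwise_head {R : List Letter} {T : STab} (h : RowStrict (R :: T)) :
    R.Pairwise (fun x y => x.ceil < y.ceil) := by
  rw [List.pairwise_iff_getElem]
  intro i j hi hj hij
  refine row_rel_of_adjacent (T := R :: T) (r := 0) (P := fun x y => x.ceil < y.ceil)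
    (fun _ _ _ => lt_trans) h hij ?_ ?_
  · simp [entry?_cons_zero]
  · simp [entry?_cons_zero]

theorem flatMap_range_of_le {f : ℕ → PWord} {k m : ℕ} (h : k ≤ m)
    (hf : ∀ c, k ≤ c → f c = []) : (List.range m).flatMap f = (List.range k).flatMap f := by
  induction m, h using Nat.le_induction with
  | base => rfl
  | succ m hm ih => simp [List.range_succ, ih, hf m hm]

theorem simK_rowWord_colWord {T : STab} (hT : IsShifted T) (hr : RowStrict T)
    (hc : ColStrict T) : simK (rowWord T) (colWord T) := by
  induction T with
  | nil => exact simK.refl _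
  | cons R T ih =>
    have hpos : 0 < R.length := hT.2 _ (by simp [shapeOf])
    obtain ⟨m, hm⟩ : ∃ m, R.length = m + 1 := ⟨R.length - 1, by omega⟩
    have hk : numCols T ≤ m := by
      rcases T with _ | ⟨R', T⟩
      · simp [numCols]
      · have : R'.length < R.length := hT.length_lt (r := 0) rfl rfl
        simp only [numCols, List.getD_cons_zero]
        omega
    have h1 := (ih hT.tail hr.tail hc.tail).append [] R
    have h2 := simK_columns_row (colDown T) R hr.pairwise_head (fun j b hb => by
      have := hT.colDown_pairwise hc (j + 1)
      rwa [colDown_cons_succ, hb] at this) m (by omega)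
    have hrow : rowWord (R :: T) = rowWord T ++ R := by simp [rowWord]
    have hcol : colWord (R :: T) =
        R.take 1 ++ (List.range m).flatMap (fun c => colDown T c ++ R[c + 1]?.toList) := by
      have hn : numCols (R :: T) = m + 1 := by simp [numCols, hm]
      rw [colWord_eq, hn, List.range_succ_eq_map, List.flatMap_cons, colDown_cons_zero,
        List.flatMap_map]
      simp only [Nat.succ_eq_add_one, colDown_cons_succ]
    rw [hrow, hcol]
    rw [← hm, List.take_length,
      flatMap_range_of_le hk (fun c hc => hT.tail.colDown_eq_nil hc), ← colWord_eq] at h2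
    rw [List.nil_append, List.nil_append] at h1
    exact h1.trans h2

/-! ## Increasing tableaux whose reading word is a primed involution word -/

theorem RinvPlus.not_primed_neighbors {z : Equiv.Perm ℤ} {u v : PWord} {x y : Letter}
    (h : u ++ x :: y :: v ∈ RinvPlus z) (hx : x.primed = true) (hy : y.primed = true) :
    y.ceil ≠ x.ceil + 1 ∧ x.ceil ≠ y.ceil + 1 := by
  have h1 := RinvPlus.fixed h hx
  have h2 := RinvPlus.fixed (u := u ++ [x]) (v := v) (by simpa using h) hy
  have h3 : unprimeWord (u ++ [x]) = unprimeWord u ++ [x.ceil] := by simp [unprimeWord]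
  rw [h3, conjProd_append_singleton] at h2
  have h4 := demazureConj_of_fixed_left h1.1 h1.2
  have h5 := demazureConj_of_fixed_right h1.1 h1.2
  constructor
  · intro hxy
    rw [hxy, h5] at h2
    omega
  · intro hxy
    rw [← hxy, h4] at h2
    omega

theorem demazureConj_succ_of_swap {σ : Equiv.Perm ℤ} {i : ℤ} (h0 : σ i = i + 1)
    (h1 : σ (i + 1) = i) (h2 : σ (i + 1 + 1) = i + 1 + 1) :
    demazureConj σ (i + 1) i = i + 1 + 1 ∧ demazureConj σ (i + 1) (i + 1) = i + 1 := by
  have e : (σ * sPerm (i + 1))⁻¹ (i + 1) = i := by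
    rw [Equiv.Perm.inv_eq_iff_eq, Equiv.Perm.mul_apply,
      sPerm_of_ne (by omega) (by omega), h0]
  have e' : (σ * sPerm (i + 1))⁻¹ (i + 1 + 1) = i + 1 := by
    rw [Equiv.Perm.inv_eq_iff_eq, Equiv.Perm.mul_apply, sPerm_left, h2]
  rw [demazureConj, demazureRight, if_pos (by omega), demazureLeft_eq, e, e', if_pos (by omega)]
  simp only [Equiv.Perm.mul_apply]
  rw [sPerm_of_ne (p := i) (by omega) (by omega), h0, sPerm_left, h2, sPerm_right]
  exact ⟨rfl, rfl⟩

theorem foldl_unprimeWord_apply_eq_iff (w : PWord) (σ : Equiv.Perm ℤ) {p q : ℤ}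
    (h : ∀ x ∈ w, p ≠ x.ceil ∧ p ≠ x.ceil + 1 ∧ q ≠ x.ceil ∧ q ≠ x.ceil + 1) :
    (unprimeWord w).foldl demazureConj σ p = q ↔ σ p = q := by
  refine foldl_demazureConj_apply_eq_iff _ _ fun x hx => ?_
  obtain ⟨y, hy, rfl⟩ := List.mem_map.1 hx
  exact h y hy

theorem conjProd_unprimeWord_fixed (w : PWord) {p : ℤ}
    (h : ∀ x ∈ w, p ≠ x.ceil ∧ p ≠ x.ceil + 1) : conjProd (unprimeWord w) p = p :=
  (foldl_unprimeWord_apply_eq_iff w 1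
    (fun x hx => ⟨(h x hx).1, (h x hx).2, (h x hx).1, (h x hx).2⟩)).2 rfl

theorem conjProd_unprimeWord_append_cons (u w : PWord) (x : Letter) :
    conjProd (unprimeWord (u ++ x :: w)) =
      (unprimeWord w).foldl demazureConj (demazureConj (conjProd (unprimeWord u)) x.ceil) := by
  simp [unprimeWord, conjProd_append]

/-- The entries of row `r` in columns less than `c`. -/
def rowLeft (T : STab) (r c : ℕ) : PWord := (T.getD r []).take (c - r)

/-- The entries of row `r` in columns at least `c`. -/
def rowRight (T : STab) (r c : ℕ) : PWord := (T.getD r []).drop (c - r)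

theorem rowRight_eq_cons {T : STab} {r c : ℕ} {x : Letter} (h : entry? T r c = some x) :
    rowRight T r c = x :: rowRight T r (c + 1) := by
  obtain ⟨hrc, R, h1, h2⟩ := entry?_eq_some.1 h
  obtain ⟨hk, he⟩ := List.getElem?_eq_some_iff.1 h2
  have hc : c + 1 - r = c - r + 1 := by omega
  rw [rowRight, rowRight, hc, List.getD_eq_getElem?_getD, h1, Option.getD_some,
    List.drop_eq_getElem_cons hk, he]

theorem rowWord_drop_eq {T : STab} {r c : ℕ} {x : Letter} (h : entry? T r c = some x) :
    rowWord (T.drop r) =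
      rowWord (T.drop (r + 1)) ++ rowLeft T r c ++ x :: rowRight T r (c + 1) := by
  obtain ⟨-, R, h1, -⟩ := entry?_eq_some.1 h
  obtain ⟨hk, he⟩ := List.getElem?_eq_some_iff.1 h1
  rw [← rowRight_eq_cons h, List.append_assoc, rowLeft, rowRight, List.take_append_drop,
    List.drop_eq_getElem_cons hk, he, List.getD_eq_getElem?_getD, h1]
  simp [rowWord]

theorem rowWord_eq_drop_append_take (T : STab) (r : ℕ) :
    rowWord T = rowWord (T.drop r) ++ rowWord (T.take r) := by
  conv_lhs => rw [← List.take_append_drop r T]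
  simp only [rowWord, List.reverse_append, List.flatten_append]

theorem mem_rowRight {T : STab} {r c : ℕ} {x : Letter} (hrc : r ≤ c) (h : x ∈ rowRight T r c) :
    ∃ c', c ≤ c' ∧ entry? T r c' = some x := by
  obtain ⟨k, hk⟩ := List.mem_iff_getElem?.1 h
  rw [rowRight, List.getElem?_drop, List.getD_eq_getElem?_getD] at hk
  rcases hR : T[r]? with _ | R
  · simp [hR] at hk
  · refine ⟨c + k, by omega, entry?_eq_some.2 ⟨by omega, R, hR, ?_⟩⟩
    rw [hR, Option.getD_some] at hk
    rw [← hk]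
    congr 1
    omega

theorem mem_rowLeft {T : STab} {r c : ℕ} {x : Letter} (h : x ∈ rowLeft T r c) :
    ∃ c', c' < c ∧ entry? T r c' = some x := by
  obtain ⟨k, hk⟩ := List.mem_iff_getElem?.1 h
  rw [rowLeft, List.getElem?_take, List.getD_eq_getElem?_getD] at hk
  split_ifs at hk with hlt
  rcases hR : T[r]? with _ | R
  · simp [hR] at hk
  · refine ⟨r + k, by omega, entry?_eq_some.2 ⟨by omega, R, hR, ?_⟩⟩
    rw [hR, Option.getD_some] at hk
    rw [← hk]
    congr 1
    omega

theorem mem_rowWord_drop {T : STab} {n : ℕ} {x : Letter} (h : x ∈ rowWord (T.drop n)) :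
    ∃ r c, n ≤ r ∧ entry? T r c = some x := by
  simp only [rowWord, List.mem_flatten, List.mem_reverse] at h
  obtain ⟨R, hR, hx⟩ := h
  obtain ⟨j, hj⟩ := List.mem_iff_getElem?.1 hR
  obtain ⟨k, hk⟩ := List.mem_iff_getElem?.1 hx
  rw [List.getElem?_drop] at hj
  refine ⟨n + j, n + j + k, by omega, entry?_eq_some.2 ⟨by omega, R, hj, ?_⟩⟩
  rwa [Nat.add_sub_cancel_left]

theorem rowStrict_of_rowWord {T : STab} {z : Equiv.Perm ℤ} (h : IsIncreasing T)
    (hz : rowWord T ∈ RinvPlus z) : RowStrict T := by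
  intro r c x y hx hy
  have hle := Letter.ceil_le_of_lt (h.1 r c x y hx hy)
  rw [rowWord_eq_drop_append_take T r, rowWord_drop_eq hx, rowRight_eq_cons hy] at hz
  simp only [List.append_assoc, List.cons_append] at hz
  rw [← List.append_assoc] at hz
  have := RinvPlus.ceil_ne hz
  omega

theorem colStrict_of_rowWord {T : STab} (hT : IsShifted T) {z : Equiv.Perm ℤ}
    (h : IsIncreasing T) (hz : rowWord T ∈ RinvPlus z) : ColStrict T := by
  have hrow := rowStrict_of_rowWord h hz
  have hrow' : ∀ {r c c' : ℕ} {x y : Letter}, c < c' → entry? T r c = some x →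
      entry? T r c' = some y → x.ceil < y.ceil := fun hc hx hy =>
    row_rel_of_adjacent (P := fun x y => x.ceil < y.ceil) (fun _ _ _ => lt_trans) hrow hc hx hy
  suffices H : ∀ c r x y, entry? T r c = some x → entry? T (r + 1) c = some y →
      x.ceil < y.ceil from fun r c => H c r
  intro c
  induction c using Nat.strong_induction_on with
  | _ c ih =>
  intro r x y hx hy
  have hrc := entry?_row hy
  by_contra hcon
  rcases Letter.lt_iff.1 (h.2 r c x y hx hy) with hlt | ⟨hxy, hxp, hyp⟩
  · exact hcon hlt
  have hword : rowWord T = (rowWord (T.drop (r + 2)) ++ rowLeft T (r + 1) c) ++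
      y :: (rowRight T (r + 1) (c + 1) ++ rowLeft T r c ++
        x :: (rowRight T r (c + 1) ++ rowWord (T.take r))) := by
    rw [rowWord_eq_drop_append_take T r, rowWord_drop_eq hx, rowWord_drop_eq hy]
    simp only [List.append_assoc, List.cons_append]
  have hright : ∀ w, entry? T (r + 1) (c + 1) = some w → x.ceil + 2 ≤ w.ceil := by
    intro w hw
    obtain ⟨v, hv⟩ := hT.entry?_below hw
    have h1 := hrow _ _ _ _ hy hw
    have h2 := hrow _ _ _ _ hx hv
    by_contra hcw
    rcases Letter.lt_iff.1 (h.2 _ _ _ _ hv hw) with h3 | ⟨h3, h4, -⟩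
    · omega
    · rw [hword, rowRight_eq_cons hv] at hz
      have := RinvPlus.not_primed_neighbors (x := x) (y := v)
        (u := (rowWord (T.drop (r + 2)) ++ rowLeft T (r + 1) c) ++
          y :: (rowRight T (r + 1) (c + 1) ++ rowLeft T r c)) (by simpa using hz) hxp h4
      omega
  have hX : ∀ w ∈ rowRight T (r + 1) (c + 1), x.ceil + 2 ≤ w.ceil := by
    intro w hw
    obtain ⟨c', hc', hw'⟩ := mem_rowRight (by omega) hw
    obtain ⟨v, hv⟩ := entry?_left (c := c + 1) (by omega) hc' hw'
    have := hright v hv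
    have := h.ceil_le hT le_rfl hc' hv hw'
    omega
  have hY : ∀ w ∈ rowLeft T r c, w.ceil < x.ceil := by
    intro w hw
    obtain ⟨c', hc', hw'⟩ := mem_rowLeft hw
    exact hrow' hc' hw' hx
  rw [hword] at hz
  have hfix := RinvPlus.fixed (x := x)
    (u := (rowWord (T.drop (r + 2)) ++ rowLeft T (r + 1) c) ++
      y :: (rowRight T (r + 1) (c + 1) ++ rowLeft T r c)) (by simpa using hz) hxp
  rw [conjProd_unprimeWord_append_cons, ← hxy] at hfix
  have hsucc := (foldl_unprimeWord_apply_eq_iff _ _ (fun w hw => by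
    rcases List.mem_append.1 hw with hw | hw
    · have := hX w hw
      omega
    · have := hY w hw
      omega)).1 hfix.2
  rcases hrc.eq_or_lt with rfl | hlt
  · have hU : ∀ w ∈ rowWord (T.drop (r + 2)) ++ rowLeft T (r + 1) (r + 1),
        x.ceil + 2 ≤ w.ceil := by
      intro w hw
      rcases List.mem_append.1 hw with hw | hw
      · obtain ⟨r', c', hr', hw'⟩ := mem_rowWord_drop hw
        obtain ⟨t, ht⟩ := hT.entry?_below_of_le (r := r + 1) (by omega) hw'
        have := entry?_row hw'
        obtain ⟨v, hv⟩ := entry?_left (c := r + 1 + 1) (by omega) (by omega) ht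
        have := hright v hv
        have := h.ceil_le hT (by omega) (by omega) hv hw'
        omega
      · simp [rowLeft] at hw
    rw [demazureConj_of_fixed_right] at hsucc
    · omega
    · exact conjProd_unprimeWord_fixed _ fun w hw => by have := hU w hw; omega
    · exact conjProd_unprimeWord_fixed _ fun w hw => by have := hU w hw; omega
  · obtain ⟨d, rfl⟩ : ∃ d, c = d + 1 := ⟨c - 1, by omega⟩
    obtain ⟨v, hv⟩ := entry?_left (c := d) (by omega) (by omega) hy
    obtain ⟨t, ht⟩ := hT.entry?_below hv
    have h1 := ih d (by omega) r t v ht hv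
    have h2 := hrow _ _ _ _ hv hy
    have hself := (foldl_unprimeWord_apply_eq_iff _ _ (fun w hw => by
      rcases List.mem_append.1 hw with hw | hw
      · have := hX w hw
        omega
      · obtain ⟨c', hc', hw'⟩ := mem_rowLeft hw
        have := h.ceil_le hT le_rfl (by omega) hw' ht
        omega)).1 hfix.1
    have := demazureConj_descent
      (conjProd (unprimeWord (rowWord (T.drop (r + 2)) ++ rowLeft T (r + 1) (d + 1)))) x.ceil
    omega

/-- The entries of column `c` in rows at least `r`, from top to bottom. -/
def colTop (T : STab) (c r : ℕ) : PWord :=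
  (List.range' r (c + 1 - r)).reverse.filterMap (fun s => entry? T s c)

/-- The entries of column `c` in rows less than `r`, from top to bottom. -/
def colBot (T : STab) (c r : ℕ) : PWord :=
  (List.range r).reverse.filterMap (fun s => entry? T s c)

theorem colTop_eq_append {T : STab} {c r : ℕ} {x : Letter} (h : entry? T r c = some x) :
    colTop T c r = colTop T c (r + 1) ++ [x] := by
  have hrc := entry?_row h
  have : c + 1 - r = c + 1 - (r + 1) + 1 := by omega
  rw [colTop, colTop, this, List.range'_succ]
  simp [h]

theorem colTop_self_succ (T : STab) (c : ℕ) : colTop T c (c + 1) = [] := by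
  simp [colTop]

theorem colDown_eq {T : STab} {c r : ℕ} {x : Letter} (h : entry? T r c = some x) :
    colDown T c = colTop T c (r + 1) ++ x :: colBot T c r := by
  have hrc := entry?_row h
  have h1 : List.range (c + 1) = List.range r ++ List.range' r (c + 1 - r) := by
    have := List.range'_append_1 (s := 0) (m := r) (n := c + 1 - r)
    rw [Nat.zero_add, Nat.add_sub_cancel' (by omega)] at this
    rw [List.range_eq_range', List.range_eq_range', this]
  have h2 : x :: colBot T c r = [x] ++ colBot T c r := rfl
  rw [h2, ← List.append_assoc, ← colTop_eq_append h, colDown, h1, List.reverse_append,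
    List.filterMap_append]
  rfl

theorem mem_colTop {T : STab} {c r : ℕ} {x : Letter} (h : x ∈ colTop T c r) :
    ∃ r', r ≤ r' ∧ entry? T r' c = some x := by
  simp only [colTop, List.mem_filterMap, List.mem_reverse, List.mem_range'_1] at h
  obtain ⟨s, hs, hx⟩ := h
  exact ⟨s, hs.1, hx⟩

theorem mem_colBot {T : STab} {c r : ℕ} {x : Letter} (h : x ∈ colBot T c r) :
    ∃ r', r' < r ∧ entry? T r' c = some x := by
  simpa only [colBot, List.mem_filterMap, List.mem_reverse, List.mem_range] using h

theorem colWord_split (T : STab) {c : ℕ} (hc : c < numCols T) :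
    ∃ V, colWord T = (List.range c).flatMap (colDown T) ++ (colDown T c ++ V) := by
  obtain ⟨d, hd⟩ : ∃ d, numCols T = c + 1 + d := ⟨numCols T - (c + 1), by omega⟩
  rw [colWord_eq, hd, List.range_add, List.range_succ, List.flatMap_append, List.flatMap_append]
  exact ⟨_, by simp only [List.flatMap_cons, List.flatMap_nil, List.append_nil,
    List.append_assoc]; rfl⟩

theorem colWord_split_two (T : STab) {c : ℕ} (hc : c + 1 < numCols T) :
    ∃ V, colWord T =
      (List.range c).flatMap (colDown T) ++ (colDown T c ++ (colDown T (c + 1) ++ V)) := by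
  obtain ⟨V, hV⟩ := colWord_split T hc
  exact ⟨V, by rw [hV, List.range_succ]; simp⟩

theorem colStrict_of_colWord {T : STab} (hT : IsShifted T) {z : Equiv.Perm ℤ}
    (h : IsIncreasing T) (hz : colWord T ∈ RinvPlus z) : ColStrict T := by
  intro r c x y hx hy
  have hle := Letter.ceil_le_of_lt (h.2 r c x y hx hy)
  obtain ⟨V, hV⟩ := colWord_split T (hT.lt_numCols hx)
  rw [hV, colDown_eq hx, colTop_eq_append hy] at hz
  have := RinvPlus.ceil_ne (u := (List.range c).flatMap (colDown T) ++ colTop T c (r + 1 + 1))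
    (x := y) (y := x) (v := colBot T c r ++ V) (by simpa using hz)
  omega

theorem rowStrict_of_colWord {T : STab} (hT : IsShifted T) {z : Equiv.Perm ℤ}
    (h : IsIncreasing T) (hz : colWord T ∈ RinvPlus z) : RowStrict T := by
  have hcol := colStrict_of_colWord hT h hz
  intro r
  induction r using Nat.strong_induction_on with
  | _ r ih =>
  intro c x y hx hy
  have hrc := entry?_row hx
  by_contra hcon
  rcases Letter.lt_iff.1 (h.1 r c x y hx hy) with hlt | ⟨hxy, hxp, hyp⟩
  · exact hcon hlt
  obtain ⟨V, hV⟩ := colWord_split_two T (hT.lt_numCols hy)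
  set P := (List.range c).flatMap (colDown T) with hP
  have hword : colWord T = (P ++ colTop T c (r + 1)) ++
      x :: (colBot T c r ++ colTop T (c + 1) (r + 1) ++ y :: (colBot T (c + 1) r ++ V)) := by
    rw [hV, colDown_eq hx, colDown_eq hy]
    simp only [List.append_assoc, List.cons_append]
  have hY : ∀ w ∈ colBot T c r, w.ceil + 2 ≤ x.ceil := by
    intro w hw
    obtain ⟨r', hr', hw'⟩ := mem_colBot hw
    obtain ⟨s, rfl⟩ : ∃ s, r = s + 1 := ⟨r - 1, by omega⟩
    obtain ⟨v, hv⟩ := hT.entry?_below hx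
    obtain ⟨t, ht⟩ := hT.entry?_below hy
    have h1 := ih s (by omega) c v t hv ht
    have h2 := hcol _ _ _ _ ht hy
    have h3 := h.ceil_le hT (by omega) le_rfl hw' hv
    omega
  rw [hword] at hz
  have hfix := RinvPlus.fixed hz hxp
  have hasc := RinvPlus.ascent (x := y) (v := colBot T (c + 1) r ++ V)
    (u := (P ++ colTop T c (r + 1)) ++ x :: (colBot T c r ++ colTop T (c + 1) (r + 1)))
    (by simpa using hz)
  rw [conjProd_unprimeWord_append_cons, ← hxy] at hasc
  have h0 := demazureConj_of_fixed_left hfix.1 hfix.2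
  have h1 := demazureConj_of_fixed_right hfix.1 hfix.2
  by_cases hex : ∃ w, entry? T (r + 1) (c + 1) = some w ∧ w.ceil = x.ceil + 1
  · obtain ⟨w, hw, hwx⟩ := hex
    rcases hrc.eq_or_lt with rfl | hlt
    · have hσ : conjProd (unprimeWord (P ++ colTop T r (r + 1))) (x.ceil + 1 + 1) =
          x.ceil + 1 + 1 := by
        refine conjProd_unprimeWord_fixed _ fun v hv => ?_
        rw [colTop_self_succ, List.append_nil, hP, List.mem_flatMap] at hv
        obtain ⟨c', hc', hv⟩ := hv
        obtain ⟨r', hv⟩ := mem_colDown.1 hv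
        have := entry?_row hv
        have := List.mem_range.1 hc'
        have := h.ceil_le hT (by omega) (by omega) hv hx
        omega
      have h2 := (demazureConj_apply_eq_iff _ (i := x.ceil) (by omega) (by omega) (by omega)
        (by omega)).2 hσ
      have hY' : ∀ {p q : ℤ}, x.ceil ≤ p → x.ceil ≤ q → ∀ v ∈ colBot T r r,
          p ≠ v.ceil ∧ p ≠ v.ceil + 1 ∧ q ≠ v.ceil ∧ q ≠ v.ceil + 1 := by
        intro p q hp hq v hv
        have := hY v hv
        omega
      have e0 := (foldl_unprimeWord_apply_eq_iff _ _ (hY' (by omega) (by omega))).2 h0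
      have e1 := (foldl_unprimeWord_apply_eq_iff _ _ (hY' (by omega) (by omega))).2 h1
      have e2 := (foldl_unprimeWord_apply_eq_iff _ _ (hY' (by omega) (by omega))).2 h2
      have := demazureConj_succ_of_swap e0 e1 e2
      have hlast : colTop T (r + 1) (r + 1) = [w] := by
        rw [colTop_eq_append hw, colTop_self_succ]; rfl
      have happ : unprimeWord (colBot T r r ++ [w]) =
          unprimeWord (colBot T r r) ++ [x.ceil + 1] := by simp [unprimeWord, hwx]
      rw [hlast, happ, List.foldl_append, List.foldl_cons, List.foldl_nil, this.1, this.2] at hasc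
      omega
    · obtain ⟨v, hv⟩ := entry?_left (c := c) hlt (by omega) hw
      have h2 := hcol _ _ _ _ hx hv
      rcases Letter.lt_iff.1 (h.1 _ _ _ _ hv hw) with h3 | ⟨h3, h4, -⟩
      · omega
      · rw [colTop_eq_append hv] at hz
        have := RinvPlus.not_primed_neighbors (u := P ++ colTop T c (r + 1 + 1)) (x := v) (y := x)
          (v := colBot T c r ++ colTop T (c + 1) (r + 1) ++ y :: (colBot T (c + 1) r ++ V))
          (by simpa using hz) h4 hxp
        omega
  · have hX : ∀ w ∈ colTop T (c + 1) (r + 1), x.ceil + 2 ≤ w.ceil := by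
      intro w hw
      obtain ⟨r', hr', hw'⟩ := mem_colTop hw
      obtain ⟨v, hv⟩ := hT.entry?_below_of_le hr' hw'
      have h2 := hcol _ _ _ _ hy hv
      have h3 := h.ceil_le hT hr' le_rfl hv hw'
      have h4 : v.ceil ≠ x.ceil + 1 := fun h4 => hex ⟨v, hv, h4⟩
      omega
    have hXY : ∀ {p q : ℤ}, x.ceil ≤ p → p ≤ x.ceil + 1 → x.ceil ≤ q → q ≤ x.ceil + 1 →
        ∀ v ∈ colBot T c r ++ colTop T (c + 1) (r + 1),
          p ≠ v.ceil ∧ p ≠ v.ceil + 1 ∧ q ≠ v.ceil ∧ q ≠ v.ceil + 1 := by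
      intro p q hp hp' hq hq' v hv
      rcases List.mem_append.1 hv with hv | hv
      · have := hY v hv
        omega
      · have := hX v hv
        omega
    have e0 := (foldl_unprimeWord_apply_eq_iff _ _
      (hXY (by omega) (by omega) (by omega) (by omega))).2 h0
    have e1 := (foldl_unprimeWord_apply_eq_iff _ _
      (hXY (by omega) (by omega) (by omega) (by omega))).2 h1
    rw [e0, e1] at hasc
    omega

/-- if `unprime(T)` is increasing then `row(T) ~ᴷ col(T)`; and if `T`
is increasing and `z ∈ I_ℤ`, then `row(T) ∈ R_inv⁺(z) ↔ col(T) ∈ R_inv⁺(z)`, in which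
case `row(T) ~ᴷ col(T)`. -/
theorem stmt3 (T : STab) (hT : IsShifted T) :
    (IsIncreasing (unprimeT T) → simK (rowWord T) (colWord T)) ∧
    (IsIncreasing T → ∀ z : Equiv.Perm ℤ, IZ z →
      (rowWord T ∈ RinvPlus z ↔ colWord T ∈ RinvPlus z) ∧
      (rowWord T ∈ RinvPlus z → simK (rowWord T) (colWord T))) := by
  refine ⟨fun h => ?_, fun h z _ => ⟨⟨fun hz => ?_, fun hz => ?_⟩, fun hz => ?_⟩⟩
  · obtain ⟨hr, hc⟩ := (isIncreasing_unprimeT_iff T).1 h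
    exact simK_rowWord_colWord hT hr hc
  · exact ((simK_rowWord_colWord hT (rowStrict_of_rowWord h hz)
      (colStrict_of_rowWord hT h hz)).mem_RinvPlus_iff z).1 hz
  · exact ((simK_rowWord_colWord hT (rowStrict_of_colWord hT h hz)
      (colStrict_of_colWord hT h hz)).mem_RinvPlus_iff z).2 hz
  · exact simK_rowWord_colWord hT (rowStrict_of_rowWord h hz) (colStrict_of_rowWord hT h hz)
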